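/- For every natural number n such that 24 divides 13n+1, the number spt((13n+1)/24) is divisible by 13. -/

import Mathlib

open Finset

/-- `spt n`: the total number of smallest parts in the partitions of `n`,
i.e. the sum over all partitions of `n` of the multiplicity of the smallest part. -/
def spt (n : ℕ) : ℕ :=
  ∑ p : Nat.Partition n, (p.parts.filter (fun j => ∀ i ∈ p.parts, j ≤ i)).card

namespace SptThirteen
open PowerSeries

section Partitions

/-- The number of partitions of `n` into parts that are all at least `m`. -/
def numParts (m n : ℕ) : ℕ :=
  #{p : Nat.Partition n | ∀ i ∈ p.parts, m ≤ i}

lemma card_le_count (m c n : ℕ) (hm : 0 < m) (hc : c * m ≤ n) :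
    #{p : Nat.Partition n | (∀ i ∈ p.parts, m ≤ i) ∧ c ≤ p.parts.count m} =
      numParts m (n - c * m) := by
  symm
  unfold numParts
  refine Finset.card_bij
    (fun p _ => ⟨p.parts + Multiset.replicate c m, ?_, ?_⟩) ?_ ?_ ?_
  · intro i hi
    rcases Multiset.mem_add.1 hi with h | h
    · exact p.parts_pos h
    · rw [Multiset.eq_of_mem_replicate h]; exact hm
  · simp [p.parts_sum]; omega
  · intro p hp
    simp only [mem_filter, mem_univ, true_and, Multiset.mem_add] at hp ⊢
    refine ⟨?_, by simp⟩
    rintro i (h | h)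
    · exact hp i h
    · rw [Multiset.eq_of_mem_replicate h]
  · intro p _ p' _ h
    ext1
    simpa using h
  · intro p hp
    simp only [mem_filter, mem_univ, true_and] at hp
    have hle : Multiset.replicate c m ≤ p.parts := Multiset.le_count_iff_replicate_le.1 hp.2
    refine ⟨⟨p.parts - Multiset.replicate c m, ?_, ?_⟩, ?_, ?_⟩
    · intro i hi
      exact p.parts_pos (Multiset.mem_of_le (Multiset.sub_le_self _ _) hi)
    · have := congrArg Multiset.sum (Multiset.sub_add_cancel hle)
      rw [Multiset.sum_add, p.parts_sum] at this
      simp at this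
      omega
    · simp only [mem_filter, mem_univ, true_and]
      intro i hi
      exact hp.1 i (Multiset.mem_of_le (Multiset.sub_le_self _ _) hi)
    · ext1
      exact Multiset.sub_add_cancel hle

lemma count_mul_le {n : ℕ} (p : Nat.Partition n) (m : ℕ) : p.parts.count m * m ≤ n := by
  have hle : Multiset.replicate (p.parts.count m) m ≤ p.parts :=
    Multiset.le_count_iff_replicate_le.1 le_rfl
  have := congrArg Multiset.sum (Multiset.sub_add_cancel hle)
  rw [Multiset.sum_add, p.parts_sum] at this
  simp at this
  omega

lemma numParts_rec (m n : ℕ) (hm : 0 < m) :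
    numParts m n = numParts (m + 1) n + if m ≤ n then numParts m (n - m) else 0 := by
  have h1 : numParts m n = #{p : Nat.Partition n | (∀ i ∈ p.parts, m ≤ i) ∧ ¬ 1 ≤ p.parts.count m}
      + #{p : Nat.Partition n | (∀ i ∈ p.parts, m ≤ i) ∧ 1 ≤ p.parts.count m} := by
    unfold numParts
    rw [add_comm, ← Finset.filter_filter, ← Finset.filter_filter,
      Finset.card_filter_add_card_filter_not]
  rw [h1]
  congr 1
  · unfold numParts
    congr 1
    ext p
    simp only [mem_filter, mem_univ, true_and, Multiset.one_le_count_iff_mem]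
    constructor
    · rintro ⟨h, h'⟩ i hi
      have := h i hi
      rcases this.eq_or_lt with h2 | h2
      · subst h2; exact absurd hi h'
      · exact h2
    · intro h
      exact ⟨fun i hi => (Nat.le_succ m).trans (h i hi), fun hi => absurd (h m hi) (by omega)⟩
  · split_ifs with h
    · simpa using card_le_count m 1 n hm (by simpa using h)
    · rw [Finset.card_eq_zero, Finset.filter_eq_empty_iff]
      rintro p - ⟨-, h2⟩
      have := count_mul_le p m
      nlinarith

lemma numParts_eq_zero (m n : ℕ) (hn : 0 < n) (h : n < m) : numParts m n = 0 := by
  unfold numParts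
  rw [Finset.card_eq_zero, Finset.filter_eq_empty_iff]
  intro p _ hp
  have : p.parts ≠ 0 := by
    intro h0
    have := p.parts_sum
    simp [h0] at this
    omega
  obtain ⟨i, hi⟩ := Multiset.exists_mem_of_ne_zero this
  have h1 := hp i hi
  have h2 : i ≤ n := by
    have := Multiset.le_sum_of_mem hi
    rwa [p.parts_sum] at this
  omega

lemma numParts_zero (m : ℕ) : numParts m 0 = 1 := by
  unfold numParts
  rw [Finset.filter_true_of_mem]
  · simp
  · intro p _ i hi
    have h1 := p.parts_pos hi
    have h2 := Multiset.le_sum_of_mem hi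
    rw [p.parts_sum] at h2
    omega

lemma spt_eq_sum (n M : ℕ) (hM : n ≤ M) :
    spt n = ∑ m ∈ Icc 1 M, ∑ c ∈ Icc 1 M, if c * m ≤ n then numParts m (n - c * m) else 0 := by
  have key : ∀ p : Nat.Partition n,
      (p.parts.filter (fun j => ∀ i ∈ p.parts, j ≤ i)).card =
      ∑ m ∈ Icc 1 M, ∑ c ∈ Icc 1 M,
        if (∀ i ∈ p.parts, m ≤ i) ∧ c ≤ p.parts.count m then 1 else 0 := by
    intro p
    have hsub : ∀ a ∈ p.parts.filter (fun j => ∀ i ∈ p.parts, j ≤ i), a ∈ Icc 1 M := by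
      intro a ha
      have ha' := Multiset.mem_of_mem_filter ha
      have h2 := Multiset.le_sum_of_mem ha'
      rw [p.parts_sum] at h2
      exact Finset.mem_Icc.2 ⟨p.parts_pos ha', h2.trans hM⟩
    rw [← Multiset.sum_count_eq_card hsub]
    refine Finset.sum_congr rfl fun m hm => ?_
    rw [Multiset.count_filter]
    split_ifs with h
    · simp only [and_iff_right h]
      rw [← Finset.card_filter]
      have h3 := count_mul_le p m
      have h4 : p.parts.count m ≤ M := by
        have := (Finset.mem_Icc.1 hm).1
        nlinarith
      have : ({c ∈ Icc 1 M | c ≤ p.parts.count m} : Finset ℕ) = Icc 1 (p.parts.count m) := by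
        ext c; simp; omega
      rw [this]; simp
    · have : ∀ c, ¬ ((∀ i ∈ p.parts, m ≤ i) ∧ c ≤ p.parts.count m) := fun c hc => h hc.1
      simp [this]
  unfold spt
  simp_rw [key]
  rw [Finset.sum_comm]
  refine Finset.sum_congr rfl fun m hm => ?_
  rw [Finset.sum_comm]
  refine Finset.sum_congr rfl fun c hc => ?_
  rw [← Finset.card_filter]
  split_ifs with h
  · exact card_le_count m c n (Finset.mem_Icc.1 hm).1 h
  · rw [Finset.card_eq_zero, Finset.filter_eq_empty_iff]
    rintro p - ⟨-, h2⟩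
    have := count_mul_le p m
    exact h ((Nat.mul_le_mul_right m h2).trans this)

/-- Generating function of `numParts m`. -/
noncomputable def numPartsSeries (m : ℕ) : ℤ⟦X⟧ := mk fun n => (numParts m n : ℤ)

lemma numPartsSeries_mul (m : ℕ) (hm : 0 < m) :
    numPartsSeries m * (1 - X ^ m) = numPartsSeries (m + 1) := by
  ext n
  rw [mul_sub, mul_one, map_sub, coeff_mul_X_pow']
  simp only [numPartsSeries, coeff_mk]
  rw [numParts_rec m n hm]
  split_ifs <;> simp

lemma numPartsSeries_mul_prod (m k : ℕ) (hm : 0 < m) :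
    numPartsSeries m * ∏ j ∈ range k, (1 - X ^ (m + j)) = numPartsSeries (m + k) := by
  induction k with
  | zero => simp
  | succ k ih =>
    rw [Finset.prod_range_succ, ← mul_assoc, ih, numPartsSeries_mul _ (by omega)]
    rfl

lemma X_pow_dvd_numPartsSeries_sub_one (m : ℕ) : (X : ℤ⟦X⟧) ^ m ∣ numPartsSeries m - 1 := by
  rw [X_pow_dvd_iff]
  intro n hn
  rcases Nat.eq_zero_or_pos n with rfl | h
  · simp [numPartsSeries, numParts_zero]
  · simp [numPartsSeries, coeff_one, numParts_eq_zero m n h hn, h.ne']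

/-- Generating function of `spt`. -/
noncomputable def sptSeries : ℤ⟦X⟧ := mk fun n => (spt n : ℤ)

lemma X_pow_dvd_sptSeries_sub (M : ℕ) :
    (X : ℤ⟦X⟧) ^ (M + 1) ∣
      sptSeries - ∑ m ∈ Icc 1 M, (∑ c ∈ Icc 1 M, X ^ (c * m)) * numPartsSeries m := by
  rw [X_pow_dvd_iff]
  intro n hn
  rw [map_sub, sub_eq_zero, sptSeries, coeff_mk, spt_eq_sum n M (by omega)]
  simp only [Finset.sum_mul, map_sum, coeff_X_pow_mul', Nat.cast_sum]
  refine Finset.sum_congr rfl fun m _ => Finset.sum_congr rfl fun c _ => ?_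
  split_ifs <;> simp [numPartsSeries]

end Partitions
end SptThirteen

namespace SptThirteen
open PowerSeries

section QSeries

/-- The `q`-Pochhammer symbol `(q; q)_n`. -/
noncomputable def poch (n : ℕ) : ℤ⟦X⟧ := ∏ i ∈ range n, (1 - X ^ (i + 1))

/-- The inverse of `1 - q ^ n`. -/
noncomputable def geom (n : ℕ) : ℤ⟦X⟧ := invOfUnit (1 - X ^ n) 1

/-- The inverse of `(q; q)_n`. -/
noncomputable def pochInv (n : ℕ) : ℤ⟦X⟧ := ∏ i ∈ range n, geom (i + 1)

lemma geom_mul (n : ℕ) : geom (n + 1) * (1 - X ^ (n + 1)) = 1 := by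
  rw [mul_comm]
  exact mul_invOfUnit _ _ (by simp)

lemma poch_succ (n : ℕ) : poch (n + 1) = poch n * (1 - X ^ (n + 1)) := by
  rw [poch, Finset.prod_range_succ, ← poch]

lemma pochInv_succ (n : ℕ) : pochInv (n + 1) = pochInv n * geom (n + 1) := by
  rw [pochInv, Finset.prod_range_succ, ← pochInv]

lemma pochInv_eq (n : ℕ) : pochInv n = pochInv (n + 1) * (1 - X ^ (n + 1)) := by
  rw [pochInv_succ, mul_assoc, geom_mul, mul_one]

lemma poch_mul_pochInv (n : ℕ) : poch n * pochInv n = 1 := by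
  induction n with
  | zero => simp [poch, pochInv]
  | succ n ih =>
    rw [poch_succ, pochInv_succ]
    linear_combination geom (n + 1) * (1 - X ^ (n + 1)) * ih + geom_mul n

lemma X_pow_dvd_poch_sub (a b : ℕ) : (X : ℤ⟦X⟧) ^ (a + 1) ∣ poch (a + b) - poch a := by
  induction b with
  | zero => simp
  | succ b ih =>
    have : poch (a + (b + 1)) - poch a =
        (poch (a + b) - poch a) - X ^ (a + 1) * (X ^ b * poch (a + b)) := by
      rw [← add_assoc, poch_succ]; ring
    rw [this]
    exact dvd_sub ih (dvd_mul_right _ _)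

/-- The exponents `r (3 r - 1) / 2`. -/
def pent (r : ℕ) : ℕ := r * (3 * r - 1) / 2

lemma pent_succ (r : ℕ) : pent (r + 1) = pent r + 3 * r + 1 := by
  unfold pent
  rcases r with _ | r
  · simp
  · have : (r + 1 + 1) * (3 * (r + 1 + 1) - 1) = (r + 1) * (3 * (r + 1) - 1) + 2 * (3 * (r + 1) + 1) := by
      have h1 : 3 * (r + 1 + 1) - 1 = 3 * r + 5 := by omega
      have h2 : 3 * (r + 1) - 1 = 3 * r + 2 := by omega
      rw [h1, h2]; ring
    rw [this]; omega

lemma le_pent (r : ℕ) : r ≤ pent r := by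
  induction r with
  | zero => simp
  | succ r ih => rw [pent_succ]; omega

/-- The sequence that forms a Bailey pair with `1 / (q; q)_n`. -/
noncomputable def alpha (r : ℕ) : ℤ⟦X⟧ :=
  if r = 0 then 1 else (-1) ^ r * X ^ pent r * (1 + X ^ r)

lemma bailey_partial (n k : ℕ) (hk : k ≤ n) :
    ∑ r ∈ range (k + 1), ((1 - X ^ (n + 1)) * (alpha r * pochInv (n + 1 - r) * pochInv (n + 1 + r))
      - alpha r * pochInv (n - r) * pochInv (n + r)) =
    (-1) ^ k * X ^ (n - k + pent (k + 1)) * pochInv (n - k) * pochInv (n + 1 + k) := by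
  induction k with
  | zero =>
    simp only [zero_add, range_one, sum_singleton, alpha, if_true, Nat.sub_zero, add_zero]
    rw [pochInv_eq n, show n + pent 1 = n + 1 from rfl]
    ring
  | succ k ih =>
    rw [Finset.sum_range_succ, ih (by omega)]
    obtain ⟨t, rfl⟩ : ∃ t, n = k + 1 + t := ⟨n - (k + 1), by omega⟩
    have e1 : k + 1 + t - k = t + 1 := by omega
    have e2 : k + 1 + t + 1 - (k + 1) = t + 1 := by omega
    have e3 : k + 1 + t - (k + 1) = t := by omega
    have e4 : k + 1 + t + 1 + k = 2 * k + t + 2 := by ring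
    have e5 : k + 1 + t + 1 + (k + 1) = 2 * k + t + 2 + 1 := by ring
    have e6 : k + 1 + t + (k + 1) = 2 * k + t + 2 := by ring
    rw [e1, e2, e3, e4, e5, e6, pochInv_eq t, pochInv_eq (2 * k + t + 2), pent_succ (k + 1)]
    simp only [alpha, Nat.succ_ne_zero, if_false]
    ring

lemma bailey_succ (n : ℕ) :
    (1 - X ^ (n + 1)) * ∑ r ∈ range (n + 2), alpha r * pochInv (n + 1 - r) * pochInv (n + 1 + r) =
      ∑ r ∈ range (n + 1), alpha r * pochInv (n - r) * pochInv (n + r) := by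
  have h := bailey_partial n n le_rfl
  rw [Finset.sum_sub_distrib, ← Finset.mul_sum] at h
  rw [Finset.sum_range_succ, mul_add, ← sub_eq_iff_eq_add'.2 (sub_eq_iff_eq_add.1 h)]
  have e5 : n + 1 + (n + 1) = 2 * n + 1 + 1 := by ring
  have e6 : n + 1 + n = 2 * n + 1 := by ring
  rw [e5, e6, pochInv_eq (2 * n + 1)]
  simp only [alpha, Nat.succ_ne_zero, if_false, Nat.sub_self, zero_add]
  ring

lemma bailey_sum (n : ℕ) :
    ∑ r ∈ range (n + 1), alpha r * pochInv (n - r) * pochInv (n + r) = pochInv n := by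
  induction n with
  | zero => simp [alpha, pochInv]
  | succ n ih =>
    have h := bailey_succ n
    rw [ih] at h
    rw [pochInv_succ, ← h]
    linear_combination (-(∑ r ∈ range (n + 2), alpha r * pochInv (n + 1 - r) * pochInv (n + 1 + r)))
      * geom_mul n

lemma telescope_sum (r t : ℕ) :
    (1 - X ^ (r + 1)) ^ 2 * ∑ i ∈ range (t + 1),
      X ^ i * poch (r + i) ^ 2 * pochInv i * pochInv (2 * (r + 1) + i) =
    poch (r + 1 + t) ^ 2 * pochInv t * pochInv (2 * (r + 1) + t) := by
  induction t with
  | zero => simp [poch_succ]; ring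
  | succ t ih =>
    rw [Finset.sum_range_succ, mul_add, ih]
    have e1 : r + 1 + (t + 1) = r + 1 + t + 1 := rfl
    have e2 : r + (t + 1) = r + 1 + t := by ring
    have e3 : 2 * (r + 1) + (t + 1) = 2 * (r + 1) + t + 1 := rfl
    rw [e1, e2, e3, poch_succ (r + 1 + t), pochInv_eq t, pochInv_eq (2 * (r + 1) + t)]
    ring

/-- Partial sums of the generating function of `spt` multiplied by `(q; q)_∞`. -/
lemma sum_geom_poch (M : ℕ) :
    ∑ n ∈ range M, X ^ (n + 1) * geom (n + 1) * poch n =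
      ∑ n ∈ range M, X ^ (n + 1) * geom (n + 1) ^ 2 +
      ∑ r ∈ range M, (-1) ^ (r + 1) * X ^ (pent (r + 1) + (r + 1)) * (1 + X ^ (r + 1)) *
        geom (r + 1) ^ 2 * (poch M ^ 2 * pochInv (M - (r + 1)) * pochInv (M + (r + 1))) := by
  have h1 : ∀ n, X ^ (n + 1) * geom (n + 1) * poch n =
      X ^ (n + 1) * geom (n + 1) ^ 2 + ∑ r ∈ range (n + 1), X ^ (n + 1) * poch n ^ 2 *
        (alpha (r + 1) * pochInv (n - r) * pochInv (n + 1 + (r + 1))) := by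
    intro n
    have h := bailey_sum (n + 1)
    rw [Finset.sum_range_succ'] at h
    simp only [Nat.add_sub_add_right, Nat.sub_zero, add_zero] at h
    rw [← Finset.mul_sum]
    have h2 := poch_mul_pochInv n
    rw [← eq_sub_iff_add_eq] at h
    rw [h, pochInv_succ]
    simp only [alpha, if_true]
    linear_combination (-(poch n * X ^ (n + 1) * geom (n + 1)) +
      (X ^ (n + 1) * geom (n + 1) ^ 2 * (1 + poch n * pochInv n))) * h2
  simp_rw [h1]
  rw [Finset.sum_add_distrib]
  congr 1
  rw [Finset.sum_sigma', Finset.sum_bij' (t := (range M).sigma fun r => range (M - r))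
    (fun x _ => (⟨x.2, x.1 - x.2⟩ : (_ : ℕ) × ℕ)) (fun x _ => (⟨x.1 + x.2, x.1⟩ : (_ : ℕ) × ℕ))
    (g := fun x => X ^ (x.1 + x.2 + 1) * poch (x.1 + x.2) ^ 2 *
      (alpha (x.1 + 1) * pochInv x.2 * pochInv (2 * (x.1 + 1) + x.2)))]
  · rw [Finset.sum_sigma]
    refine Finset.sum_congr rfl fun r hr => ?_
    have hr' := Finset.mem_range.1 hr
    obtain ⟨t, rfl⟩ : ∃ t, M = r + 1 + t := ⟨M - (r + 1), by omega⟩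
    have h := telescope_sum r t
    have e1 : r + 1 + t - r = t + 1 := by omega
    have e2 : r + 1 + t - (r + 1) = t := by omega
    have e3 : r + 1 + t + (r + 1) = 2 * (r + 1) + t := by ring
    rw [e1, e2, e3, ← h]
    have hg : geom (r + 1) ^ 2 * (1 - X ^ (r + 1)) ^ 2 = 1 := by rw [← mul_pow, geom_mul, one_pow]
    simp only [alpha, Nat.succ_ne_zero, if_false]
    have h3 : ∀ Y : ℤ⟦X⟧, (-1) ^ (r + 1) * X ^ (pent (r + 1) + (r + 1)) * (1 + X ^ (r + 1)) *
        geom (r + 1) ^ 2 * ((1 - X ^ (r + 1)) ^ 2 * Y) =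
        (-1) ^ (r + 1) * X ^ (pent (r + 1) + (r + 1)) * (1 + X ^ (r + 1)) * Y := by
      intro Y
      linear_combination (-1) ^ (r + 1) * X ^ (pent (r + 1) + (r + 1)) * (1 + X ^ (r + 1)) * Y * hg
    rw [h3, Finset.mul_sum]
    refine Finset.sum_congr rfl fun i _ => ?_
    ring
  · intro x hx
    simp only [mem_sigma, mem_range] at hx ⊢; omega
  · intro x hx
    simp only [mem_sigma, mem_range] at hx ⊢; omega
  · rintro ⟨a, b⟩ hx
    simp only [mem_sigma, mem_range] at hx
    simp only [Sigma.mk.injEq, heq_eq_eq, and_true]; omega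
  · rintro ⟨a, b⟩ hx
    simp
  · rintro ⟨a, b⟩ hx
    simp only [mem_sigma, mem_range] at hx
    have e1 : b + (a - b) = a := by omega
    have e2 : 2 * (b + 1) + (a - b) = a + 1 + (b + 1) := by omega
    simp only [e1, e2]

end QSeries
end SptThirteen

namespace SptThirteen
open PowerSeries

section DoubleSeries

variable {R : Type*} [CommRing R]

/-- The double series `∑ w r i * X ^ e r i`. -/
noncomputable def dsum (e : ℕ → ℕ → ℕ) (w : ℕ → ℕ → R) : R⟦X⟧ :=
  mk fun N => ∑ r ∈ range (N + 1), ∑ i ∈ range (N + 1), if e r i = N then w r i else 0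

lemma coeff_dsum {e : ℕ → ℕ → ℕ} (he : ∀ r i, r ≤ e r i ∧ i ≤ e r i) (w : ℕ → ℕ → R)
    {N M : ℕ} (h : N < M) :
    coeff N (dsum e w) = ∑ r ∈ range M, ∑ i ∈ range M, if e r i = N then w r i else 0 := by
  rw [dsum, coeff_mk]
  have hs : range (N + 1) ⊆ range M := Finset.range_subset_range.2 h
  rw [Finset.sum_subset hs]
  · refine Finset.sum_congr rfl fun r _ => Finset.sum_subset hs ?_
    intro i _ hi
    have := he r i
    simp only [mem_range] at hi
    exact if_neg (by omega)
  · intro r _ hr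
    refine Finset.sum_eq_zero fun i _ => ?_
    have := he r i
    simp only [mem_range] at hr
    exact if_neg (by omega)

lemma X_pow_dvd_dsum_sub {e : ℕ → ℕ → ℕ} (he : ∀ r i, r ≤ e r i ∧ i ≤ e r i) (w : ℕ → ℕ → R)
    (M : ℕ) :
    X ^ M ∣ dsum e w - ∑ r ∈ range M, ∑ i ∈ range M, C (w r i) * X ^ e r i := by
  rw [X_pow_dvd_iff]
  intro n hn
  rw [map_sub, coeff_dsum he w hn, sub_eq_zero]
  simp only [map_sum, coeff_C_mul, coeff_X_pow]
  refine Finset.sum_congr rfl fun r _ => Finset.sum_congr rfl fun i _ => ?_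
  by_cases h : e r i = n
  · simp [h]
  · simp [h, Ne.symm h]

lemma map_dsum {S : Type*} [CommRing S] (f : R →+* S) (e : ℕ → ℕ → ℕ) (w : ℕ → ℕ → R) :
    map f (dsum e w) = dsum e (fun r i => f (w r i)) := by
  ext n
  simp only [dsum, coeff_map, coeff_mk, map_sum]
  refine Finset.sum_congr rfl fun r _ => Finset.sum_congr rfl fun i _ => ?_
  split_ifs <;> simp

variable (R) in
/-- The series `∑ σ_j(n) q ^ n`. -/
noncomputable def S (j : ℕ) : R⟦X⟧ :=
  dsum (fun r i => (r + 1) * (i + 1)) (fun _ i => ((i + 1 : ℕ) : R) ^ j)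

/-- The exponents `n (3 n + k) / 2` for `n = r + 1` and `k = 2 i + 1`. -/
def aexp (r i : ℕ) : ℕ := pent (r + 1) + (r + 1) + (r + 1) * i

variable (R) in
/-- The series `∑ (-1) ^ n k ^ j q ^ (n (3 n + k) / 2)` over `n ≥ 1` and odd `k ≥ 1`. -/
noncomputable def A (j : ℕ) : R⟦X⟧ :=
  dsum aexp (fun r i => (-1) ^ (r + 1) * ((2 * i + 1 : ℕ) : R) ^ j)

lemma sexp_le (r i : ℕ) : r ≤ (r + 1) * (i + 1) ∧ i ≤ (r + 1) * (i + 1) := by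
  constructor <;> nlinarith

lemma aexp_le (r i : ℕ) : r ≤ aexp r i ∧ i ≤ aexp r i := by
  have := le_pent (r + 1)
  unfold aexp
  constructor <;> nlinarith

lemma sum_succ_mul_pow (y : R) (M : ℕ) :
    (∑ i ∈ range M, ((i + 1 : ℕ) : R) * y ^ (i + 1)) * (1 - y) ^ 2 =
      y - (M + 1) * y ^ (M + 1) + M * y ^ (M + 2) := by
  induction M with
  | zero => simp
  | succ M ih => rw [Finset.sum_range_succ, add_mul, ih]; push_cast; ring

lemma sum_odd_mul_pow (y : R) (M : ℕ) :
    (∑ i ∈ range M, ((2 * i + 1 : ℕ) : R) * y ^ i) * (1 - y) ^ 2 =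
      1 + y - (2 * M + 1) * y ^ M + (2 * M - 1) * y ^ (M + 1) := by
  induction M with
  | zero => simp
  | succ M ih => rw [Finset.sum_range_succ, add_mul, ih]; push_cast; ring

end DoubleSeries

section SptSeries

lemma coeff_pentagonalSeries_eq (n M : ℕ) (h : n < M) :
    coeff n (poch M) = coeff n (pentagonalSeries ℤ) := by
  obtain ⟨s, hs⟩ := Filter.eventually_atTop.1 (coeff_prod_one_sub_X_pow_eventually_eq ℤ n)
  obtain ⟨K, hK⟩ := s.exists_nat_subset_range
  have h1 := hs (range (M + K)) (hK.trans (Finset.range_subset_range.2 (by omega)))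
  have h2 := (X_pow_dvd_iff.1 (X_pow_dvd_poch_sub M K)) n (by omega)
  rw [map_sub, sub_eq_zero] at h2
  rw [← h1, ← h2]; rfl

lemma eq_of_forall_quotient {R : Type*} [CommRing R] {a b : R⟦X⟧}
    (h : ∀ M, Ideal.Quotient.mk (Ideal.span {(X : R⟦X⟧) ^ M}) a = Ideal.Quotient.mk _ b) : a = b := by
  ext n
  have := h (n + 1)
  rw [Ideal.Quotient.eq, Ideal.mem_span_singleton, X_pow_dvd_iff] at this
  simpa [sub_eq_zero] using this n (by omega)

lemma quotient_eq_iff {R : Type*} [CommRing R] {a b : R⟦X⟧} {M : ℕ} :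
    Ideal.Quotient.mk (Ideal.span {(X : R⟦X⟧) ^ M}) a = Ideal.Quotient.mk _ b ↔ X ^ M ∣ a - b := by
  rw [Ideal.Quotient.eq, Ideal.mem_span_singleton]

theorem pentagonalSeries_mul_sptSeries :
    pentagonalSeries ℤ * sptSeries = S ℤ 1 + A ℤ 1 := by
  refine eq_of_forall_quotient fun M => ?_
  set π := Ideal.Quotient.mk (Ideal.span {(X : ℤ⟦X⟧) ^ M}) with hπ
  have hX : ∀ k, M ≤ k → π (X ^ k) = 0 := by
    intro k hk
    rw [← map_zero π, quotient_eq_iff, sub_zero]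
    exact pow_dvd_pow _ hk
  have hE : π (pentagonalSeries ℤ) = π (poch M) := by
    rw [quotient_eq_iff, X_pow_dvd_iff]
    intro n hn
    rw [map_sub, coeff_pentagonalSeries_eq n M hn, sub_self]
  have hgeom : ∀ n, π (geom (n + 1)) * (1 - π X ^ (n + 1)) = 1 := by
    intro n
    have := congrArg π (geom_mul n)
    simpa using this
  have hS : π (S ℤ 1) = π (∑ n ∈ range M, X ^ (n + 1) * geom (n + 1) ^ 2) := by
    rw [S, quotient_eq_iff.2 (X_pow_dvd_dsum_sub sexp_le _ M), map_sum, map_sum]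
    refine Finset.sum_congr rfl fun r _ => ?_
    have h1 := sum_succ_mul_pow (π X ^ (r + 1)) M
    have h2 := hX ((r + 1) * (M + 1)) (by nlinarith)
    have h3 := hX ((r + 1) * (M + 2)) (by nlinarith)
    rw [map_pow] at h2 h3
    simp only [← pow_mul, h2, h3] at h1
    have h4 : π (∑ i ∈ range M, C ((((i + 1 : ℕ) : ℤ)) ^ 1) * X ^ ((r + 1) * (i + 1))) =
        ∑ i ∈ range M, ((i + 1 : ℕ) : ℤ⟦X⟧ ⧸ Ideal.span {(X : ℤ⟦X⟧) ^ M}) * π X ^ ((r + 1) * (i + 1)) := by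
      simp
    rw [h4]
    simp only [map_mul, map_pow]
    have h5 := hgeom r
    set s := ∑ i ∈ range M,
        ((i + 1 : ℕ) : ℤ⟦X⟧ ⧸ Ideal.span {(X : ℤ⟦X⟧) ^ M}) * π X ^ ((r + 1) * (i + 1))
    linear_combination π (geom (r + 1)) ^ 2 * h1 -
      s * (1 + π (geom (r + 1)) * (1 - π X ^ (r + 1))) * h5
  have hA : π (A ℤ 1) = π (∑ r ∈ range M, (-1) ^ (r + 1) * X ^ (pent (r + 1) + (r + 1)) *
      (1 + X ^ (r + 1)) * geom (r + 1) ^ 2) := by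
    rw [A, quotient_eq_iff.2 (X_pow_dvd_dsum_sub aexp_le _ M), map_sum, map_sum]
    refine Finset.sum_congr rfl fun r _ => ?_
    have h1 := sum_odd_mul_pow (π X ^ (r + 1)) M
    have h2 := hX ((r + 1) * M) (by nlinarith)
    have h3 := hX ((r + 1) * (M + 1)) (by nlinarith)
    rw [map_pow] at h2 h3
    simp only [← pow_mul, h2, h3] at h1
    have h4 : π (∑ i ∈ range M, C ((-1) ^ (r + 1) * (((2 * i + 1 : ℕ) : ℤ)) ^ 1) * X ^ (aexp r i)) =
        (-1) ^ (r + 1) * π X ^ (pent (r + 1) + (r + 1)) *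
        ∑ i ∈ range M, ((2 * i + 1 : ℕ) : ℤ⟦X⟧ ⧸ Ideal.span {(X : ℤ⟦X⟧) ^ M}) * π X ^ ((r + 1) * i) := by
      rw [Finset.mul_sum, map_sum]
      refine Finset.sum_congr rfl fun i _ => ?_
      rw [aexp, pow_add _ _ ((r + 1) * i), pow_one, map_mul C, map_natCast C, map_pow C, map_neg C,
        map_one C]
      simp only [map_mul, map_pow, map_neg, map_one, map_natCast]
      ring
    rw [h4]
    simp only [map_mul, map_pow, map_add, map_neg, map_one]
    have h5 := hgeom r
    set s := ∑ i ∈ range M,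
        ((2 * i + 1 : ℕ) : ℤ⟦X⟧ ⧸ Ideal.span {(X : ℤ⟦X⟧) ^ M}) * π X ^ ((r + 1) * i)
    linear_combination (-1) ^ (r + 1) * π X ^ (pent (r + 1) + (r + 1)) * (π (geom (r + 1)) ^ 2 * h1 -
      s * (1 + π (geom (r + 1)) * (1 - π X ^ (r + 1))) * h5)
  have hspt : π (pentagonalSeries ℤ * sptSeries) =
      π (∑ n ∈ range M, X ^ (n + 1) * geom (n + 1) * poch n) := by
    rw [map_mul, hE, quotient_eq_iff.2 ((pow_dvd_pow _ (Nat.le_succ M)).trans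
      (X_pow_dvd_sptSeries_sub M)), ← map_mul, Finset.mul_sum, map_sum, map_sum,
      ← Finset.Ico_add_one_right_eq_Icc, Finset.sum_Ico_eq_sum_range]
    refine Finset.sum_congr (by simp) fun n hn => ?_
    have hn := Finset.mem_range.1 hn
    obtain ⟨t, rfl⟩ : ∃ t, M = n + t := ⟨M - n, by omega⟩
    have h1 : poch (n + t) = poch n * ∏ j ∈ range t, (1 - X ^ (n + 1 + j)) := by
      rw [poch, Finset.prod_range_add, ← poch]
      congr 1
      exact Finset.prod_congr rfl fun j _ => by ring_nf
    have h2 := numPartsSeries_mul_prod (n + 1) t (by omega)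
    have h3 : π (numPartsSeries (n + 1 + t)) = 1 := by
      rw [← map_one π, quotient_eq_iff]
      exact (pow_dvd_pow _ (by omega)).trans (X_pow_dvd_numPartsSeries_sub_one _)
    have h4 : π (∑ c ∈ Icc 1 (n + t), X ^ (c * (1 + n))) = π (X ^ (n + 1) * geom (n + 1)) := by
      have e : (∑ c ∈ Icc 1 (n + t), (X : ℤ⟦X⟧) ^ (c * (1 + n))) =
          X ^ (n + 1) * ∑ c ∈ range (n + t), (X ^ (n + 1)) ^ c := by
        rw [← Finset.Ico_add_one_right_eq_Icc, Finset.sum_Ico_eq_sum_range, Finset.mul_sum]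
        refine Finset.sum_congr (by simp) fun c _ => ?_
        rw [← pow_mul, ← pow_add]; ring_nf
      have h5 := geom_sum_mul_neg ((X : ℤ⟦X⟧) ^ (n + 1)) (n + t)
      have h6 := congrArg π h5
      have h7 := hX ((n + 1) * (n + t)) (by nlinarith)
      rw [← pow_mul, map_sub, h7] at h6
      have h8 := congrArg π (geom_mul n)
      rw [e]
      simp only [map_mul, map_one] at h6 h8 ⊢
      set s := π (∑ c ∈ range (n + t), (X ^ (n + 1)) ^ c)
      linear_combination π (X ^ (n + 1)) * (π (geom (n + 1)) * h6 - s * h8)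
    have h9 : poch (n + t) * ((∑ c ∈ Icc 1 (n + t), X ^ (c * (1 + n))) * numPartsSeries (1 + n)) =
        (∑ c ∈ Icc 1 (n + t), X ^ (c * (1 + n))) * poch n * numPartsSeries (n + 1 + t) := by
      rw [h1, ← h2, add_comm 1 n]; ring
    rw [Finset.Ico_add_one_right_eq_Icc, h9, map_mul, map_mul, h3, h4, map_mul _ _ (poch n),
      mul_one]
  rw [hspt, sum_geom_poch, map_add, map_add, hS, hA, map_sum _ _ (range M), map_sum _ _ (range M),
    map_sum _ _ (range M)]
  congr 1
  refine Finset.sum_congr rfl fun r hr => ?_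
  have hr := Finset.mem_range.1 hr
  obtain ⟨t, rfl⟩ : ∃ t, M = r + 1 + t := ⟨M - (r + 1), by omega⟩
  have e1 : r + 1 + t - (r + 1) = t := by omega
  rw [e1]
  have h1 : π (poch (r + 1 + t) * pochInv (r + 1 + t + (r + 1))) = 1 := by
    rw [← map_one π, ← poch_mul_pochInv (r + 1 + t + (r + 1)), map_mul, map_mul]
    congr 1
    rw [eq_comm, quotient_eq_iff]
    exact (pow_dvd_pow _ (by omega)).trans (X_pow_dvd_poch_sub (r + 1 + t) (r + 1))
  have h2 : π (X ^ (r + 1) * (poch (r + 1 + t) * pochInv t)) = π (X ^ (r + 1)) := by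
    rw [quotient_eq_iff]
    have h3 := X_pow_dvd_poch_sub t (r + 1)
    rw [add_comm t (r + 1)] at h3
    have h4 : (X : ℤ⟦X⟧) ^ (r + 1) * (poch (r + 1 + t) * pochInv t) - X ^ (r + 1) =
        X ^ (r + 1) * (poch (r + 1 + t) - poch t) * pochInv t := by
      linear_combination X ^ (r + 1) * poch_mul_pochInv t
    rw [h4]
    refine Dvd.dvd.mul_right ?_ _
    refine (pow_dvd_pow _ (show r + 1 + t ≤ (r + 1) + (t + 1) by omega)).trans ?_
    rw [pow_add]
    exact mul_dvd_mul_left _ h3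
  simp only [map_mul, pow_add X (pent (r + 1)), map_pow π (poch _)] at h1 h2 ⊢
  linear_combination π ((-1) ^ (r + 1)) * π (X ^ pent (r + 1)) * π (1 + X ^ (r + 1)) *
    π (geom (r + 1) ^ 2) * (h2 + π (X ^ (r + 1)) * π (poch (r + 1 + t)) * π (pochInv t) * h1)

end SptSeries
end SptThirteen

namespace SptThirteen
open PowerSeries

section Euler

variable {R : Type*} [CommRing R]

variable (R) in
/-- The derivation `q d/dq`. -/
noncomputable def dq : Derivation R R⟦X⟧ R⟦X⟧ := (X : R⟦X⟧) • derivative R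

@[simp] lemma coeff_dq (f : R⟦X⟧) (n : ℕ) : coeff n (dq R f) = n * coeff n f := by
  rcases n with _ | n
  · simp [dq]
  · simp [dq, coeff_succ_X_mul, coeff_derivative, mul_comm]

lemma dq_mul (f g : R⟦X⟧) : dq R (f * g) = dq R f * g + f * dq R g := by
  rw [Derivation.leibniz, smul_eq_mul, smul_eq_mul]; ring

lemma map_dq {T : Type*} [CommRing T] (φ : R →+* T) (f : R⟦X⟧) :
    map φ (dq R f) = dq T (map φ f) := by
  ext n; simp

lemma dq_X_pow (n : ℕ) : dq R (X ^ n) = (n : R⟦X⟧) * X ^ n := by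
  ext m
  rw [coeff_dq, ← map_natCast (C (R := R)) n, coeff_C_mul, coeff_X_pow]
  split_ifs with h <;> simp [h]

lemma dq_poch (n : ℕ) :
    dq ℤ (poch n) = -poch n * ∑ i ∈ range n, (i + 1 : ℤ⟦X⟧) * X ^ (i + 1) * geom (i + 1) := by
  induction n with
  | zero => simp [poch]
  | succ n ih =>
    rw [poch_succ, dq_mul, ih, map_sub, dq_X_pow, Derivation.map_one_eq_zero,
      Finset.sum_range_succ]
    push_cast
    linear_combination (poch n * (n + 1) * X ^ (n + 1)) * geom_mul n

theorem dq_pentagonalSeries : dq ℤ (pentagonalSeries ℤ) = -S ℤ 1 * pentagonalSeries ℤ := by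
  refine eq_of_forall_quotient fun M => ?_
  set π := Ideal.Quotient.mk (Ideal.span {(X : ℤ⟦X⟧) ^ M}) with hπ
  have hX : ∀ k, M ≤ k → π (X ^ k) = 0 := by
    intro k hk
    rw [← map_zero π, quotient_eq_iff, sub_zero]
    exact pow_dvd_pow _ hk
  have hE : π (pentagonalSeries ℤ) = π (poch M) := by
    rw [quotient_eq_iff, X_pow_dvd_iff]
    intro n hn
    rw [map_sub, coeff_pentagonalSeries_eq n M hn, sub_self]
  have hD : π (dq ℤ (pentagonalSeries ℤ)) = π (dq ℤ (poch M)) := by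
    rw [quotient_eq_iff, X_pow_dvd_iff]
    intro n hn
    rw [map_sub, coeff_dq, coeff_dq, coeff_pentagonalSeries_eq n M hn, sub_self]
  have hS : π (S ℤ 1) = π (∑ i ∈ range M, (i + 1 : ℤ⟦X⟧) * X ^ (i + 1) * geom (i + 1)) := by
    rw [S, quotient_eq_iff.2 (X_pow_dvd_dsum_sub sexp_le _ M), Finset.sum_comm, map_sum, map_sum]
    refine Finset.sum_congr rfl fun i _ => ?_
    have h1 := geom_sum_mul_neg (π X ^ (i + 1)) M
    have h2 := hX ((i + 1) * M) (by nlinarith)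
    rw [map_pow] at h2
    rw [← pow_mul, h2] at h1
    have h3 := congrArg π (geom_mul i)
    have h4 : π (∑ r ∈ range M, C (((i + 1 : ℕ) : ℤ) ^ 1) * X ^ ((r + 1) * (i + 1))) =
        (i + 1) * π X ^ (i + 1) * ∑ r ∈ range M, (π X ^ (i + 1)) ^ r := by
      rw [Finset.mul_sum, map_sum]
      refine Finset.sum_congr rfl fun r _ => ?_
      rw [pow_one, map_natCast C, map_mul, map_natCast, map_pow, ← pow_mul, mul_assoc, ← pow_add]
      push_cast
      ring_nf
    rw [h4]
    simp only [map_mul, map_sub, map_pow, map_one, map_add, map_natCast] at h3 ⊢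
    set s := ∑ r ∈ range M, (π X ^ (i + 1)) ^ r
    linear_combination (i + 1) * π X ^ (i + 1) * (π (geom (i + 1)) * h1 - s * h3)
  rw [hD, dq_poch, map_mul, map_mul, map_neg, map_neg, hE, hS]
  ring

lemma map_pentagonalSeries {T : Type*} [CommRing T] :
    map (Int.castRingHom T) (pentagonalSeries ℤ) = pentagonalSeries T := by
  ext n
  rw [coeff_map]
  by_cases h : n ∈ Set.range pentagonal
  · obtain ⟨k, rfl⟩ := h
    rw [coeff_pentagonalSeries_pentagonal, coeff_pentagonalSeries_pentagonal]
    simp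
  · rw [coeff_pentagonalSeries_eq_zero _ h, coeff_pentagonalSeries_eq_zero _ h]
    simp

lemma map_S {T : Type*} [CommRing T] (φ : R →+* T) (j : ℕ) : map φ (S R j) = S T j := by
  simp [S, map_dsum]

lemma map_A {T : Type*} [CommRing T] (φ : R →+* T) (j : ℕ) : map φ (A R j) = A T j := by
  simp only [A, map_dsum, map_mul, map_pow, map_neg, map_one, map_natCast]

end Euler
end SptThirteen

namespace SptThirteen
open PowerSeries

section Convolution

open LaurentPolynomial (T)

/-- Coefficientwise application of an additive map. -/
noncomputable def cmap {R R' : Type*} [CommRing R] [CommRing R'] (φ : R →+ R') :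
    R⟦X⟧ →+ R'⟦X⟧ where
  toFun f := mk fun n => φ (coeff n f)
  map_zero' := by ext; simp
  map_add' f g := by ext; simp

@[simp] lemma coeff_cmap {R R' : Type*} [CommRing R] [CommRing R'] (φ : R →+ R') (f : R⟦X⟧)
    (n : ℕ) : coeff n (cmap φ f) = φ (coeff n f) := by
  simp [cmap]

/-- The inclusion of series in `q` into series with Laurent polynomial coefficients. -/
noncomputable def incl : ℤ⟦X⟧ →+* (LaurentPolynomial ℤ)⟦X⟧ := map LaurentPolynomial.C

lemma C_eq_intCast (c : ℤ) : (LaurentPolynomial.C c : LaurentPolynomial ℤ) = (c : ℤ) :=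
  eq_intCast LaurentPolynomial.C c

lemma cmap_incl_mul {R : Type*} [CommRing R] (φ : LaurentPolynomial ℤ →+ R) (P : ℤ⟦X⟧)
    (f : (LaurentPolynomial ℤ)⟦X⟧) :
    cmap φ (incl P * f) = map (Int.castRingHom R) P * cmap φ f := by
  ext n
  simp only [coeff_cmap, coeff_mul, incl, coeff_map, map_sum]
  refine Finset.sum_congr rfl fun p _ => ?_
  rw [C_eq_intCast, ← zsmul_eq_mul, map_zsmul, zsmul_eq_mul]
  simp

/-- The coefficient of `z ^ m`, as an additive map. -/
noncomputable def lcoeff (m : ℤ) : LaurentPolynomial ℤ →+ ℤ where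
  toFun f := f.coeff m
  map_zero' := by simp
  map_add' f g := by simp

/-- The coefficient series of `z ^ m`. -/
noncomputable def row (f : (LaurentPolynomial ℤ)⟦X⟧) (m : ℤ) : ℤ⟦X⟧ := cmap (lcoeff m) f

lemma coeff_row (f : (LaurentPolynomial ℤ)⟦X⟧) (m : ℤ) (n : ℕ) :
    coeff n (row f m) = (coeff n f).coeff m := by
  rw [row, coeff_cmap]; rfl

lemma row_ext {f g : (LaurentPolynomial ℤ)⟦X⟧} (h : ∀ m, row f m = row g m) : f = g := by
  ext n m
  rw [← coeff_row, h, coeff_row]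

lemma row_add (f g : (LaurentPolynomial ℤ)⟦X⟧) (m : ℤ) : row (f + g) m = row f m + row g m :=
  map_add _ _ _

lemma row_sub (f g : (LaurentPolynomial ℤ)⟦X⟧) (m : ℤ) : row (f - g) m = row f m - row g m :=
  map_sub _ _ _

lemma row_incl_mul (P : ℤ⟦X⟧) (f : (LaurentPolynomial ℤ)⟦X⟧) (m : ℤ) :
    row (incl P * f) m = P * row f m := by
  rw [row, cmap_incl_mul]
  congr 1

/-- The monomial `z ^ k`. -/
noncomputable def zpw (k : ℤ) : (LaurentPolynomial ℤ)⟦X⟧ := C (T k)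

lemma zpw_add (k l : ℤ) : zpw (k + l) = zpw k * zpw l := by
  rw [zpw, LaurentPolynomial.T_add, map_mul]; rfl

lemma zpw_zero : zpw 0 = 1 := by simp [zpw]

lemma row_zpw_mul (k : ℤ) (f : (LaurentPolynomial ℤ)⟦X⟧) (m : ℤ) :
    row (zpw k * f) m = row f (m - k) := by
  ext n
  rw [coeff_row, zpw, coeff_C_mul, coeff_row, LaurentPolynomial.T,
    AddMonoidAlgebra.coeff_single_mul_eq_mul_coeff (m₂ := m - k)]
  · rw [one_mul]
  · intro a _
    constructor <;> intro h <;> omega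

lemma row_one (m : ℤ) : row 1 m = if m = 0 then 1 else 0 := by
  ext n
  rw [coeff_row, coeff_one]
  have h : (1 : LaurentPolynomial ℤ).coeff m = if m = 0 then 1 else 0 := by
    rw [AddMonoidAlgebra.one_def, AddMonoidAlgebra.coeff_single, Finsupp.single_apply]
    simp only [eq_comm]
  split_ifs with h1 h2 h2
  · rw [h, if_pos h2, coeff_one, if_pos h1]
  · rw [h, if_neg h2, map_zero]
  · rw [coeff_one, if_neg h1]; rfl
  · rw [map_zero]; rfl

lemma row_zpw (k m : ℤ) : row (zpw k) m = if m = k then 1 else 0 := by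
  rw [← mul_one (zpw k), row_zpw_mul, row_one]
  simp only [sub_eq_zero]

/-- Coefficients indexed by the integers. -/
noncomputable def zc (b : ℤ) (f : ℤ⟦X⟧) : ℤ := if b < 0 then 0 else coeff b.toNat f

lemma zc_of_neg {b : ℤ} (h : b < 0) (f : ℤ⟦X⟧) : zc b f = 0 := if_pos h

lemma zc_natCast (n : ℕ) (f : ℤ⟦X⟧) : zc n f = coeff n f := by simp [zc]

lemma zc_add (b : ℤ) (f g : ℤ⟦X⟧) : zc b (f + g) = zc b f + zc b g := by
  unfold zc; split_ifs <;> simp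

lemma zc_sub (b : ℤ) (f g : ℤ⟦X⟧) : zc b (f - g) = zc b f - zc b g := by
  unfold zc; split_ifs <;> simp

lemma zc_neg (b : ℤ) (f : ℤ⟦X⟧) : zc b (-f) = -zc b f := by
  unfold zc; split_ifs <;> simp

lemma zc_zero (b : ℤ) : zc b 0 = 0 := by
  unfold zc; split_ifs <;> simp

lemma zc_ext {f g : ℤ⟦X⟧} (h : ∀ b, zc b f = zc b g) : f = g := by
  ext n
  rw [← zc_natCast, h, zc_natCast]

lemma zc_X_pow_mul (b : ℤ) (m : ℕ) (f : ℤ⟦X⟧) : zc (b + m) (X ^ m * f) = zc b f := by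
  unfold zc
  rw [coeff_X_pow_mul']
  split_ifs with h1 h2 h3 h4 h5
  · rfl
  · omega
  · omega
  · congr 2; omega
  · rfl
  · omega

/-- Convolution of a series in `z`, `q` with a bilateral family of series in `q`. -/
noncomputable def conv (f : (LaurentPolynomial ℤ)⟦X⟧) (g : ℤ → ℤ⟦X⟧) (N j : ℤ) : ℤ :=
  ∑ᶠ p : ℤ × ℤ, zc p.1 (row f p.2) * zc (N - p.1) (g (j - p.2))

lemma conv_finite (f : (LaurentPolynomial ℤ)⟦X⟧) (g : ℤ → ℤ⟦X⟧) (N j : ℤ) :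
    (Function.support fun p : ℤ × ℤ =>
      zc p.1 (row f p.2) * zc (N - p.1) (g (j - p.2))).Finite := by
  refine Set.Finite.subset (Finset.finite_toSet ((Finset.range (N.toNat + 1)).biUnion fun a =>
    (coeff a f).coeff.support.image fun i => ((a : ℤ), i))) ?_
  rintro ⟨a, i⟩ h
  rw [Function.mem_support] at h
  have h1 : 0 ≤ a := by
    by_contra! h'
    exact h (by simp [zc_of_neg h'])
  have h2 : a ≤ N := by
    by_contra! h'
    exact h (by rw [zc_of_neg (b := N - a) (by omega), mul_zero])
  lift a to ℕ using h1
  have h3 := left_ne_zero_of_mul h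
  rw [zc_natCast, coeff_row] at h3
  simp only [coe_biUnion, coe_image, Set.mem_iUnion, Set.mem_image, Finset.mem_coe, mem_range]
  exact ⟨a, by omega, i, by simpa using h3, rfl⟩

lemma conv_of_neg (f : (LaurentPolynomial ℤ)⟦X⟧) (g : ℤ → ℤ⟦X⟧) {N : ℤ} (h : N < 0) (j : ℤ) :
    conv f g N j = 0 := by
  rw [conv, ← finsum_zero (α := ℤ × ℤ)]
  congr 1
  ext ⟨a, i⟩
  by_cases ha : a < 0
  · simp [zc_of_neg ha]
  · simp [zc_of_neg (b := N - a) (by omega)]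

lemma conv_add (f : (LaurentPolynomial ℤ)⟦X⟧) (g g' : ℤ → ℤ⟦X⟧) (N j : ℤ) :
    conv f (fun m => g m + g' m) N j = conv f g N j + conv f g' N j := by
  rw [conv, conv, conv, ← finsum_add_distrib (conv_finite _ _ _ _) (conv_finite _ _ _ _)]
  simp only [zc_add, mul_add]

lemma conv_sub (f : (LaurentPolynomial ℤ)⟦X⟧) (g g' : ℤ → ℤ⟦X⟧) (N j : ℤ) :
    conv f (fun m => g m - g' m) N j = conv f g N j - conv f g' N j := by
  rw [conv, conv, conv, ← finsum_sub_distrib (conv_finite _ _ _ _) (conv_finite _ _ _ _)]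
  simp only [zc_sub, mul_sub]

lemma conv_neg (f : (LaurentPolynomial ℤ)⟦X⟧) (g : ℤ → ℤ⟦X⟧) (N j : ℤ) :
    conv f (fun m => -g m) N j = -conv f g N j := by
  rw [conv, conv, ← finsum_neg_distrib]
  simp only [zc_neg, mul_neg]

lemma conv_row (f g : (LaurentPolynomial ℤ)⟦X⟧) (N j : ℤ) :
    conv f (row g) N j = zc N (row (f * g) j) := by
  by_cases hN : N < 0
  · rw [conv_of_neg _ _ hN, zc_of_neg hN]
  lift N to ℕ using by omega
  rw [zc_natCast, coeff_row, coeff_mul, Finset.Nat.sum_antidiagonal_eq_sum_range_succ_mk,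
    conv, finsum_curry _ (conv_finite _ _ _ _),
    finsum_eq_sum_of_support_subset (s := (range (N + 1)).map Nat.castEmbedding), sum_map]
  · rw [AddMonoidAlgebra.coeff_sum, Finsupp.finsetSum_apply]
    refine Finset.sum_congr rfl fun a ha => ?_
    rw [mem_range] at ha
    rw [AddMonoidAlgebra.coeff_mul_apply_left, Finsupp.sum,
      finsum_eq_sum_of_support_subset (s := (coeff a f).coeff.support)]
    · refine Finset.sum_congr rfl fun i _ => ?_
      simp only [Nat.castEmbedding_apply]
      rw [zc_natCast, coeff_row, ← Nat.cast_sub (by omega), zc_natCast, coeff_row, neg_add_eq_sub]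
    · intro i hi
      have := left_ne_zero_of_mul (Function.mem_support.1 hi)
      simp only [Nat.castEmbedding_apply, zc_natCast, coeff_row] at this
      simpa using this
  · intro a ha
    have h1 : 0 ≤ a := by
      by_contra! h'
      exact ha (by simp [zc_of_neg h'])
    have h2 : a ≤ N := by
      by_contra! h'
      exact ha (by simp [zc_of_neg (b := N - a) (by omega)])
    lift a to ℕ using h1
    simp
    omega

lemma conv_one_sub_zpw_mul (f : (LaurentPolynomial ℤ)⟦X⟧) (g : ℤ → ℤ⟦X⟧) :
    conv ((1 - zpw (-1)) * f) g = conv f (fun m => g m - g (m + 1)) := by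
  ext N j
  rw [conv_sub f g (fun m => g (m + 1))]
  have h : conv f (fun m => g (m + 1)) N j =
      ∑ᶠ p : ℤ × ℤ, zc p.1 (row (zpw (-1) * f) p.2) * zc (N - p.1) (g (j - p.2)) := by
    rw [conv, ← finsum_comp_equiv ((Equiv.refl ℤ).prodCongr (Equiv.addRight (1 : ℤ)))]
    refine finsum_congr fun p => ?_
    rw [row_zpw_mul]
    simp only [Equiv.prodCongr_apply, Prod.map, Equiv.refl_apply, Equiv.coe_addRight]
    rw [show j - (p.2 + 1) + 1 = j - p.2 by ring, sub_neg_eq_add]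
  rw [h, conv, conv, ← finsum_sub_distrib (conv_finite _ _ _ _) (conv_finite (zpw (-1) * f) _ _ _)]
  refine finsum_congr fun p => ?_
  rw [sub_mul, one_mul, row_sub, zc_sub, sub_mul]

/-- A quasi-periodicity relation for a convolution. -/
lemma conv_shift {f : (LaurentPolynomial ℤ)⟦X⟧} {ε w v : ℤ}
    (hf : ∀ a i, zc (a + i + w) (row f (i + w)) = ε * zc a (row f i)) {g g' : ℤ → ℤ⟦X⟧}
    (hg : ∀ b m, zc (b + m + v) (g (m + v)) = zc b (g' m)) (N j : ℤ) :
    conv f g (N + j + w + v) (j + w + v) = ε * conv f g' N j := by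
  rw [conv, conv, ← smul_eq_mul, smul_finsum, ← finsum_comp_equiv (⟨fun p => (p.1 + p.2 + w,
      p.2 + w),
    fun p => (p.1 - p.2, p.2 - w), fun p => by ext <;> simp, fun p => by ext <;> simp⟩ :
      (ℤ × ℤ) ≃ (ℤ × ℤ))]
  refine finsum_congr fun p => ?_
  simp only [Equiv.coe_fn_mk]
  rw [hf, smul_eq_mul, mul_assoc, ← hg]
  congr 4 <;> ring_nf

end Convolution
end SptThirteen

namespace SptThirteen
open PowerSeries

section SingleSeries

variable {R : Type*} [CommRing R]

/-- The series `∑ w n * X ^ e n`. -/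
noncomputable def rsum (e : ℕ → ℕ) (w : ℕ → R) : R⟦X⟧ :=
  mk fun N => ∑ n ∈ range (N + 1), if e n = N then w n else 0

lemma coeff_rsum {e : ℕ → ℕ} (he : ∀ n, n ≤ e n) (w : ℕ → R) {N M : ℕ} (h : N < M) :
    coeff N (rsum e w) = ∑ n ∈ range M, if e n = N then w n else 0 := by
  rw [rsum, coeff_mk]
  refine Finset.sum_subset (Finset.range_subset_range.2 h) ?_
  intro n _ hn
  have := he n
  simp only [mem_range] at hn
  exact if_neg (by omega)

lemma rsum_eq_add {e : ℕ → ℕ} (he : ∀ n, n ≤ e n) (w : ℕ → R) :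
    rsum e w = C (w 0) * X ^ e 0 + rsum (fun n => e (n + 1)) (fun n => w (n + 1)) := by
  ext N
  rw [coeff_rsum he w (show N < N + 2 by omega), Finset.sum_range_succ', map_add, coeff_C_mul,
    coeff_X_pow, rsum, coeff_mk, add_comm]
  congr 1
  by_cases h : e 0 = N
  · simp [h]
  · simp [h, Ne.symm h]

lemma X_pow_mul_rsum {e : ℕ → ℕ} (he : ∀ n, n ≤ e n) (w : ℕ → R) (k : ℕ) :
    X ^ k * rsum e w = rsum (fun n => k + e n) w := by
  ext N
  rw [coeff_X_pow_mul']
  split_ifs with h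
  · rw [coeff_rsum he w (show N - k < N + 1 by omega), rsum, coeff_mk]
    refine Finset.sum_congr rfl fun n _ => ?_
    congr 1
    exact propext (by omega)
  · rw [rsum, coeff_mk]
    exact (Finset.sum_eq_zero fun n _ => if_neg (by omega)).symm

lemma rsum_neg (e : ℕ → ℕ) (w : ℕ → R) : rsum e (fun n => -w n) = -rsum e w := by
  ext N
  rw [map_neg, rsum, rsum, coeff_mk, coeff_mk, ← Finset.sum_neg_distrib]
  exact Finset.sum_congr rfl fun n _ => by split_ifs <;> simp

lemma dsum_ite {e : ℕ → ℕ → ℕ} (he : ∀ r i, r ≤ e r i ∧ i ≤ e r i) (i₀ : ℕ) (w : ℕ → R) :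
    dsum e (fun r i => if i = i₀ then w r else 0) = rsum (fun r => e r i₀) w := by
  ext N
  rw [coeff_dsum he _ (show N < N + i₀ + 1 by omega),
    coeff_rsum (fun r => (he r i₀).1) w (show N < N + i₀ + 1 by omega)]
  refine Finset.sum_congr rfl fun r _ => ?_
  rw [Finset.sum_eq_single i₀]
  · simp
  · intro i _ hi
    simp [hi]
  · intro h
    simp at h

lemma cmap_dsum {R' : Type*} [CommRing R'] (φ : R →+ R') (e : ℕ → ℕ → ℕ) (w : ℕ → ℕ → R) :
    cmap φ (dsum e w) = dsum e (fun r i => φ (w r i)) := by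
  ext n
  simp only [dsum, coeff_cmap, coeff_mk, map_sum]
  refine Finset.sum_congr rfl fun r _ => Finset.sum_congr rfl fun i _ => ?_
  split_ifs <;> simp

lemma cmap_rsum {R' : Type*} [CommRing R'] (φ : R →+ R') (e : ℕ → ℕ) (w : ℕ → R) :
    cmap φ (rsum e w) = rsum e (fun r => φ (w r)) := by
  ext n
  simp only [rsum, coeff_cmap, coeff_mk, map_sum]
  refine Finset.sum_congr rfl fun r _ => ?_
  split_ifs <;> simp

end SingleSeries

section Theta

open LaurentPolynomial (T)

/-- Triangular numbers. -/
def tri (n : ℕ) : ℕ := ∑ i ∈ range (n + 1), i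

lemma tri_succ (n : ℕ) : tri (n + 1) = tri n + (n + 1) := Finset.sum_range_succ _ _

lemma le_tri (n : ℕ) : n ≤ tri n := by
  cases n with
  | zero => simp
  | succ n => rw [tri_succ]; omega

lemma tri_mul_two (n : ℕ) : tri n * 2 = (n + 1) * n := Finset.sum_range_id_mul_two _

lemma lcoeff_T (m k : ℤ) : lcoeff m (T k) = if m = k then 1 else 0 := by
  change (T k : LaurentPolynomial ℤ).coeff m = _
  rw [LaurentPolynomial.T_apply]
  simp only [eq_comm]

/-- The theta series divided by its trivial zero. -/
noncomputable def tau : (LaurentPolynomial ℤ)⟦X⟧ :=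
  rsum tri (fun n => (-1) ^ n * ∑ i ∈ Finset.Icc (-n : ℤ) n, T i)

/-- The theta series `∑ (-1) ^ i q ^ (i (i + 1) / 2) z ^ i`. -/
noncomputable def theta : (LaurentPolynomial ℤ)⟦X⟧ := (1 - zpw (-1)) * tau

lemma row_tau (m : ℤ) :
    row tau m = rsum tri (fun n => if m.natAbs ≤ n then (-1) ^ n else 0) := by
  rw [row, tau, cmap_rsum]
  congr 1
  ext n
  have h : ((-1) ^ n * ∑ i ∈ Finset.Icc (-n : ℤ) n, T i : LaurentPolynomial ℤ) =
      ((-1) ^ n : ℤ) • ∑ i ∈ Finset.Icc (-n : ℤ) n, T i := by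
    rw [zsmul_eq_mul]; push_cast; rfl
  rw [h, map_zsmul, map_sum]
  simp only [lcoeff_T, Finset.sum_ite_eq, Finset.mem_Icc, smul_eq_mul, mul_ite, mul_one, mul_zero]
  congr 1
  exact propext (by omega)

lemma rsum_single {e : ℕ → ℕ} (he : ∀ n, n ≤ e n) (k : ℕ) (c : ℤ) :
    rsum e (fun n => if n = k then c else 0) = C c * X ^ e k := by
  ext N
  rw [coeff_rsum he _ (show N < N + k + 1 by omega), coeff_C_mul, coeff_X_pow,
    Finset.sum_eq_single k]
  · by_cases h : e k = N
    · simp [h]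
    · simp [h, Ne.symm h]
  · intro n _ hn
    simp [hn]
  · intro h
    simp at h

lemma rsum_sub {R : Type*} [CommRing R] (e : ℕ → ℕ) (v w : ℕ → R) :
    rsum e v - rsum e w = rsum e (fun n => v n - w n) := by
  ext N
  rw [map_sub, rsum, rsum, rsum, coeff_mk, coeff_mk, coeff_mk, ← Finset.sum_sub_distrib]
  exact Finset.sum_congr rfl fun n _ => by split_ifs <;> simp

lemma row_theta (m : ℤ) : row theta m = row tau m - row tau (m + 1) := by
  rw [theta, sub_mul, one_mul, row_sub, row_zpw_mul, sub_neg_eq_add]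

lemma row_theta_natCast (n : ℕ) : row theta n = C ((-1) ^ n) * X ^ tri n := by
  rw [row_theta, row_tau, row_tau, rsum_sub, ← rsum_single le_tri]
  congr 1
  ext k
  have h : ((n : ℤ) + 1).natAbs = n + 1 := by omega
  rw [Int.natAbs_natCast, h]
  split_ifs with h1 h2 h3 h3 h3 h3 <;> first | omega | simp
  rw [h3]

lemma row_theta_neg (m : ℤ) : row theta (-1 - m) = -row theta m := by
  rw [row_theta, row_theta, row_tau, row_tau, row_tau, row_tau,
    show (-1 - m).natAbs = (m + 1).natAbs by omega, show (-1 - m + 1).natAbs = m.natAbs by omega,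
    neg_sub]

lemma row_theta_succ (n : ℕ) : row theta (n + 1 : ℕ) = -(X ^ (n + 1) * row theta n) := by
  rw [row_theta_natCast, row_theta_natCast, tri_succ, pow_succ, pow_add, mul_neg_one, map_neg]
  ring

lemma zc_theta_shift (a i : ℤ) :
    zc (a + i + 1) (row theta (i + 1)) = -1 * zc a (row theta i) := by
  rcases lt_trichotomy i (-1) with h | rfl | h
  · obtain ⟨n, rfl⟩ : ∃ n : ℕ, i = -1 - (n + 1 : ℕ) := ⟨(-i - 2).toNat, by omega⟩
    have h1 : (-1 - ((n + 1 : ℕ) : ℤ) + 1) = -1 - (n : ℤ) := by push_cast; ring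
    rw [h1, row_theta_neg, row_theta_neg, row_theta_succ, neg_neg,
      ← zc_X_pow_mul _ (n + 1), mul_neg, zc_neg, neg_one_mul]
    congr 2
    push_cast
    ring
  · have := row_theta_neg 0
    rw [sub_zero] at this
    rw [this, zc_neg]
    simp
  · obtain ⟨n, rfl⟩ : ∃ n : ℕ, i = n := ⟨i.toNat, by omega⟩
    rw [← Nat.cast_add_one, row_theta_succ, zc_neg, add_assoc, ← Nat.cast_add_one, zc_X_pow_mul,
      neg_one_mul]

/-- The derivation `z d/dz` on Laurent polynomials. -/
noncomputable def lder : LaurentPolynomial ℤ →+ LaurentPolynomial ℤ where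
  toFun f := AddMonoidAlgebra.ofCoeff
    (Finsupp.onFinset f.coeff.support (fun m => m * f.coeff m) (by simp +contextual))
  map_zero' := by ext; simp
  map_add' f g := by ext; simp [mul_add]

/-- The derivation `z d/dz`. -/
noncomputable def dz : (LaurentPolynomial ℤ)⟦X⟧ →+ (LaurentPolynomial ℤ)⟦X⟧ := cmap lder

lemma row_dz (f : (LaurentPolynomial ℤ)⟦X⟧) (m : ℤ) : row (dz f) m = (m : ℤ⟦X⟧) * row f m := by
  ext n
  rw [coeff_row, dz, coeff_cmap, ← zsmul_eq_mul, map_zsmul, coeff_row]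
  rfl

lemma zc_intCast_mul (b m : ℤ) (f : ℤ⟦X⟧) : zc b ((m : ℤ⟦X⟧) * f) = m * zc b f := by
  rw [← zsmul_eq_mul]
  unfold zc
  split_ifs
  · simp
  · rw [map_zsmul, smul_eq_mul]

lemma dz_mul (f g : (LaurentPolynomial ℤ)⟦X⟧) : dz (f * g) = dz f * g + f * dz g := by
  refine row_ext fun m => zc_ext fun b => ?_
  rw [row_dz, row_add, zc_add, zc_intCast_mul, ← conv_row, ← conv_row, ← conv_row, conv, conv,
    conv, ← finsum_add_distrib (conv_finite _ _ _ _) (conv_finite _ _ _ _), ← smul_eq_mul,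
    smul_finsum]
  refine finsum_congr fun p => ?_
  rw [row_dz, row_dz, zc_intCast_mul, zc_intCast_mul, smul_eq_mul]
  ring

lemma dz_zpw (k : ℤ) : dz (zpw k) = (k : (LaurentPolynomial ℤ)⟦X⟧) * zpw k := by
  refine row_ext fun m => ?_
  rw [row_dz, row_zpw, ← map_intCast incl, row_incl_mul, row_zpw]
  split_ifs with h <;> simp [h]

lemma dz_one : dz 1 = 0 := by
  have := dz_zpw 0
  rwa [zpw_zero, Int.cast_zero, zero_mul] at this

lemma row_dq (f : (LaurentPolynomial ℤ)⟦X⟧) (m : ℤ) : row (dq _ f) m = dq ℤ (row f m) := by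
  ext n
  rw [coeff_row, coeff_dq, coeff_dq, coeff_row, ← nsmul_eq_mul]
  rw [AddMonoidAlgebra.coeff_smul_apply]; simp

lemma heat_theta : 2 * dq _ theta = dz (dz theta) + dz theta := by
  have key : ∀ n : ℕ, 2 * dq ℤ (row theta n) = (n * n + n) * row theta n := by
    intro n
    ext N
    rw [row_theta_natCast]
    have h2 : (2 : ℤ⟦X⟧) = C 2 := by simp
    have hn : ((n : ℤ⟦X⟧) * n + n) = C ((n : ℤ) * n + n) := by simp
    rw [h2, hn, coeff_C_mul, coeff_dq, coeff_C_mul, coeff_C_mul, coeff_C_mul, coeff_X_pow]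
    split_ifs with h
    · have := tri_mul_two n
      rw [h]
      zify at this
      linear_combination (-1) ^ n * this
    · simp
  refine row_ext fun m => ?_
  have h2 : (2 : (LaurentPolynomial ℤ)⟦X⟧) = incl 2 := (map_ofNat incl 2).symm
  rw [h2, row_incl_mul, row_add, row_dz, row_dz, row_dq]
  rcases le_or_gt 0 m with h | h
  · lift m to ℕ using h
    rw [key]; push_cast; ring
  · obtain ⟨n, rfl⟩ : ∃ n : ℕ, m = -1 - n := ⟨(-m - 1).toNat, by omega⟩
    rw [row_theta_neg, map_neg]
    push_cast
    linear_combination -key n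

end Theta
end SptThirteen

namespace SptThirteen
open PowerSeries

section LogDerivative

open LaurentPolynomial (T)

/-- The series `2 ∑ q ^ (n m) (z ^ m - z ^ (-m))`. -/
noncomputable def ell : (LaurentPolynomial ℤ)⟦X⟧ :=
  dsum (fun r i => (r + 1) * (i + 1)) (fun _ i => 2 * (T ((i + 1 : ℕ) : ℤ) - T (-((i + 1 : ℕ) : ℤ))))

lemma lcoeff_two_mul (m : ℤ) (f : LaurentPolynomial ℤ) : lcoeff m (2 * f) = 2 * lcoeff m f := by
  rw [two_mul, map_add, two_mul]

lemma row_ell_succ (k : ℕ) :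
    row ell (k + 1 : ℕ) = rsum (fun r => (r + 1) * (k + 1)) (fun _ => 2) := by
  rw [row, ell, cmap_dsum, ← dsum_ite (e := fun r i => (r + 1) * (i + 1)) sexp_le k]
  congr 1
  ext r i
  rw [lcoeff_two_mul, map_sub, lcoeff_T, lcoeff_T]
  by_cases h : i = k
  · subst h
    rw [if_pos rfl, if_pos rfl, if_neg (by omega)]; rfl
  · rw [if_neg (by omega), if_neg (by omega), if_neg h]; rfl

lemma row_ell_neg (m : ℤ) : row ell (-m) = -row ell m := by
  ext n
  rw [row, row, ell, cmap_dsum, cmap_dsum, map_neg, dsum, dsum, coeff_mk, coeff_mk,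
    ← Finset.sum_neg_distrib]
  refine Finset.sum_congr rfl fun r _ => ?_
  rw [← Finset.sum_neg_distrib]
  refine Finset.sum_congr rfl fun i _ => ?_
  rw [lcoeff_two_mul, map_sub, lcoeff_two_mul, map_sub, lcoeff_T, lcoeff_T, lcoeff_T, lcoeff_T]
  simp only [neg_inj, show (-m = ((i + 1 : ℕ) : ℤ)) = (m = -((i + 1 : ℕ) : ℤ)) from
    propext (by omega)]
  split_ifs <;> simp

lemma row_ell_zero : row ell 0 = 0 := by
  have h := row_ell_neg 0
  rw [neg_zero] at h
  ext n
  have h2 := congrArg (coeff n) h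
  rw [map_neg] at h2
  rw [map_zero]
  omega

/-- The Fourier coefficients of `ell` corrected by its principal part. -/
noncomputable def ellFull (m : ℤ) : ℤ⟦X⟧ := row ell m + if 0 < m then 2 else if m = 0 then 1 else 0

lemma ellFull_zero : ellFull 0 = 1 := by simp [ellFull, row_ell_zero]

lemma ellFull_neg (m : ℤ) : ellFull (-m) = 2 - ellFull m := by
  rw [ellFull, ellFull, row_ell_neg]
  rcases lt_trichotomy m 0 with h | rfl | h
  · rw [if_pos (by omega), if_neg (by omega), if_neg (by omega)]; ring
  · simp; ring
  · rw [if_neg (by omega), if_neg (by omega), if_pos h]; ring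

lemma ellFull_natCast (k : ℕ) : X ^ (k + 1) * ellFull (k + 1 : ℕ) = ellFull (k + 1 : ℕ) - 2 := by
  rw [ellFull, if_pos (by omega), row_ell_succ]
  have he : ∀ r : ℕ, r ≤ (r + 1) * (k + 1) := fun r => by nlinarith
  have h := X_pow_mul_rsum (R := ℤ) he (fun _ => 2) (k + 1)
  have h2 := rsum_eq_add (R := ℤ) he (fun _ => 2)
  have h3 : (fun r => k + 1 + (r + 1) * (k + 1)) = fun r => (r + 1 + 1) * (k + 1) := by
    ext r; ring
  rw [h3] at h
  have h4 : (C (2 : ℤ) : ℤ⟦X⟧) = 2 := by simp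
  rw [h4, zero_add, one_mul] at h2
  linear_combination h - h2

lemma zc_ellFull_shift (b m : ℤ) :
    zc (b + m + 0) (ellFull (m + 0) - 2 + if m + 0 = 0 then 2 else 0) = zc b (ellFull m) := by
  rw [add_zero, add_zero]
  rcases lt_trichotomy m 0 with h | rfl | h
  · obtain ⟨n, rfl⟩ : ∃ n : ℕ, m = -((n + 1 : ℕ) : ℤ) := ⟨(-m - 1).toNat, by omega⟩
    rw [if_neg h.ne, ellFull_neg, ← zc_X_pow_mul _ (n + 1)]
    have := ellFull_natCast n
    rw [show (2 - ellFull ((n + 1 : ℕ) : ℤ)) = -(X ^ (n + 1) * ellFull (n + 1 : ℕ)) by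
      linear_combination this, neg_add_cancel_right]
    congr 1
    linear_combination -X ^ (n + 1) * this
  · simp [ellFull_zero]
  · obtain ⟨n, rfl⟩ : ∃ n : ℕ, m = ((n + 1 : ℕ) : ℤ) := ⟨(m - 1).toNat, by omega⟩
    rw [if_neg h.ne', add_zero, ← ellFull_natCast, zc_X_pow_mul]

lemma conv_theta_const (c : ℤ⟦X⟧) (N j : ℤ) : conv theta (fun _ => c) N j = 0 := by
  rw [theta, conv_one_sub_zpw_mul]
  simp [conv, zc_zero]

lemma conv_ite (f : (LaurentPolynomial ℤ)⟦X⟧) (N j : ℤ) :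
    conv f (fun m => if m = 0 then 2 else 0) N j = 2 * zc N (row f j) := by
  have h : (fun m : ℤ => if m = 0 then (2 : ℤ⟦X⟧) else 0) = row (incl 2 * 1) := by
    ext1 m
    rw [row_incl_mul, row_one]
    simp
  rw [h, conv_row, mul_comm, mul_assoc, one_mul, row_incl_mul]
  exact zc_intCast_mul N 2 _

/-- The defect in the logarithmic derivative formula for the theta series. -/
noncomputable def defect (N j : ℤ) : ℤ := conv theta ellFull N j + (2 * j + 1) * zc N (row theta j)

lemma defect_shift (N j : ℤ) : defect (N + j + 1) (j + 1) = -defect N j := by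
  have h := conv_shift (g := fun m => ellFull m - 2 + if m = 0 then 2 else 0) (g' := ellFull)
    zc_theta_shift zc_ellFull_shift N j
  rw [conv_add theta (fun m => ellFull m - 2) (fun m => if m = 0 then 2 else 0),
    conv_sub theta ellFull (fun _ => 2), conv_theta_const, conv_ite, add_zero, add_zero,
    zc_theta_shift] at h
  rw [defect, defect, zc_theta_shift]
  linear_combination h

lemma defect_neg (N j : ℤ) : defect N (-1 - j) = defect N j := by
  have h : conv theta ellFull N (-1 - j) = conv theta ellFull N j := by
    have h2 : conv theta ellFull N j = conv theta (fun m => ellFull m - 2) N j := by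
      rw [conv_sub theta ellFull (fun _ => 2), conv_theta_const, sub_zero]
    rw [h2, conv, conv,
      ← finsum_comp_equiv ((Equiv.refl ℤ).prodCongr (Equiv.subLeft (-1 : ℤ)))]
    refine finsum_congr fun p => ?_
    simp only [Equiv.prodCongr_apply, Prod.map, Equiv.refl_apply, Equiv.subLeft_apply]
    rw [row_theta_neg, show -1 - j - (-1 - p.2) = -(j - p.2) by ring, ellFull_neg,
      ← neg_sub (ellFull _), zc_neg, zc_neg, neg_mul_neg]
  rw [defect, defect, h, row_theta_neg, zc_neg]
  ring

lemma defect_eq_zero (N j : ℤ) : defect N j = 0 := by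
  have h0 : ∀ N, defect N 0 = 0 := by
    intro N
    have h1 := defect_shift N (-1)
    have h2 := defect_neg N 0
    rw [sub_zero] at h2
    rw [neg_add_cancel, neg_add_cancel_right, h2] at h1
    omega
  have h1 : ∀ j : ℕ, ∀ N, defect N j = 0 := by
    intro j
    induction j with
    | zero => exact h0
    | succ j ih =>
      intro N
      have := defect_shift (N - j - 1) j
      rw [ih, neg_zero, show N - j - 1 + j + 1 = N by ring] at this
      exact_mod_cast this
  rcases le_or_gt 0 j with h | h
  · lift j to ℕ using h
    exact h1 j N
  · obtain ⟨n, rfl⟩ : ∃ n : ℕ, j = -1 - n := ⟨(-j - 1).toNat, by omega⟩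
    rw [defect_neg, h1]

lemma ellFull_sub (m : ℤ) :
    ellFull m - ellFull (m + 1) = row ((1 - zpw (-1)) * ell - (1 + zpw (-1))) m := by
  rw [row_sub, row_add, sub_mul, one_mul, row_sub, row_zpw_mul, row_zpw, row_one, sub_neg_eq_add,
    ellFull, ellFull]
  by_cases h0 : m = 0
  · subst h0; simp; ring
  by_cases h1 : m = -1
  · subst h1; simp; ring
  rw [if_neg h0, if_neg h1, if_neg (show m + 1 ≠ 0 by omega)]
  rcases le_or_gt m 0 with h | h
  · rw [if_neg (by omega), if_neg (by omega)]; ring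
  · rw [if_pos (by omega), if_pos (by omega)]; ring

lemma one_sub_zpw_ne_zero : (1 - zpw (-1)) ≠ 0 := by
  intro h
  have h2 : row (1 - zpw (-1)) 0 = 0 := by rw [h]; exact map_zero _
  rw [row_sub, row_one, row_zpw] at h2
  simp at h2

theorem two_mul_dz_tau : 2 * dz tau = -(ell * tau) := by
  have h : tau * ((1 - zpw (-1)) * ell - (1 + zpw (-1))) + (2 * dz theta + theta) = 0 := by
    refine row_ext fun j => zc_ext fun N => ?_
    have h1 := defect_eq_zero N j
    have h2 : (2 : (LaurentPolynomial ℤ)⟦X⟧) = incl 2 := (map_ofNat incl 2).symm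
    rw [defect, theta, conv_one_sub_zpw_mul, ← theta, funext ellFull_sub, conv_row] at h1
    have h3 : row (0 : (LaurentPolynomial ℤ)⟦X⟧) j = 0 := map_zero _
    rw [row_add, zc_add, row_add, h2, row_incl_mul, row_dz, zc_add, h3, zc_zero, ← h1]
    have h4 := zc_intCast_mul N (2 * j) (row theta j)
    push_cast at h4
    rw [mul_assoc] at h4
    rw [h4]
    ring
  have h2 : dz theta = zpw (-1) * tau + (1 - zpw (-1)) * dz tau := by
    rw [theta, dz_mul, map_sub, dz_one, dz_zpw]
    push_cast
    ring
  rw [h2, theta] at h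
  refine mul_left_cancel₀ one_sub_zpw_ne_zero ?_
  linear_combination h

end LogDerivative
end SptThirteen

namespace SptThirteen
open PowerSeries

section Moments

open LaurentPolynomial (T)

lemma dq_zpw_mul (k : ℤ) (f : (LaurentPolynomial ℤ)⟦X⟧) :
    dq _ (zpw k * f) = zpw k * dq _ f := by
  ext1 n
  rw [coeff_dq, zpw, coeff_C_mul, coeff_C_mul, coeff_dq]
  ring

lemma dz_dq (f : (LaurentPolynomial ℤ)⟦X⟧) : dz (dq _ f) = dq _ (dz f) := by
  refine row_ext fun m => ?_
  rw [row_dz, row_dq, row_dq, row_dz, dq_mul, ← zsmul_one, map_zsmul, Derivation.map_one_eq_zero]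
  simp

lemma isUnit_tau : IsUnit tau := by
  rw [isUnit_iff_constantCoeff, ← coeff_zero_eq_constantCoeff_apply, tau, rsum, coeff_mk]
  simp [tri]

/-- The logarithmic `q d/dq`-derivative of `tau`. -/
noncomputable def rho : (LaurentPolynomial ℤ)⟦X⟧ := dq _ tau * ↑(isUnit_tau.unit⁻¹)

lemma rho_mul_tau : rho * tau = dq _ tau := by
  rw [rho, mul_assoc, isUnit_tau.val_inv_mul, mul_one]

lemma tau_ne_zero : tau ≠ 0 := isUnit_tau.ne_zero

lemma two_mul_dz_rho : 2 * dz rho = -dq _ ell := by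
  have h1 := congrArg (dq _) two_mul_dz_tau
  rw [two_mul, map_add, map_neg, dq_mul, ← dz_dq, ← rho_mul_tau, dz_mul] at h1
  refine mul_right_cancel₀ tau_ne_zero ?_
  linear_combination h1 - rho * two_mul_dz_tau

lemma dz_theta : dz theta = zpw (-1) * tau + (1 - zpw (-1)) * dz tau := by
  rw [theta, dz_mul, map_sub, dz_one, dz_zpw]
  push_cast
  ring

lemma rho_eq : (1 - zpw (-1)) * (8 * rho - ell ^ 2 + 2 * dz ell) = -2 * (1 + zpw (-1)) * ell := by
  have h1 := heat_theta
  have h2 : dz (dz theta) =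
      -zpw (-1) * tau + 2 * zpw (-1) * dz tau + (1 - zpw (-1)) * dz (dz tau) := by
    rw [dz_theta, map_add, dz_mul, dz_mul, map_sub, dz_one, dz_zpw]
    push_cast
    ring
  have h3 : dq _ theta = (1 - zpw (-1)) * (rho * tau) := by
    rw [theta, rho_mul_tau, sub_mul, one_mul, map_sub, dq_zpw_mul, sub_mul, one_mul]
  have h4 := congrArg dz two_mul_dz_tau
  rw [two_mul, map_add, map_neg, dz_mul] at h4
  rw [h2, h3, dz_theta] at h1
  refine mul_right_cancel₀ tau_ne_zero ?_
  linear_combination 4 * h1 + 2 * (1 - zpw (-1)) * h4 +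
    (2 * (1 + zpw (-1)) - (1 - zpw (-1)) * ell) * two_mul_dz_tau

/-- The moment functional `z ^ m ↦ (2 m + s) ^ n`. -/
noncomputable def lmom (s : ℤ) (n : ℕ) : LaurentPolynomial ℤ →+ ℤ where
  toFun f := f.coeff.sum fun m c => c * (2 * m + s) ^ n
  map_zero' := by simp
  map_add' f g := by
    rw [AddMonoidAlgebra.coeff_add]
    exact Finsupp.sum_add_index' (h := fun m c => c * (2 * m + s) ^ n) (fun _ => zero_mul _)
      fun _ _ _ => add_mul _ _ _

lemma lmom_C_mul_T (s : ℤ) (n : ℕ) (c m : ℤ) :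
    lmom s n (LaurentPolynomial.C c * T m) = c * (2 * m + s) ^ n := by
  rw [← LaurentPolynomial.single_eq_C_mul_T]
  change (AddMonoidAlgebra.single m c).coeff.sum (fun m c : ℤ => c * (2 * m + s) ^ n) = _
  rw [AddMonoidAlgebra.coeff_single, Finsupp.sum_single_index]
  ring

lemma lmom_T (s : ℤ) (n : ℕ) (m : ℤ) : lmom s n (T m) = (2 * m + s) ^ n := by
  have := lmom_C_mul_T s n 1 m
  rwa [map_one, one_mul, one_mul] at this

lemma lmom_mul (s s' : ℤ) (n : ℕ) (f g : LaurentPolynomial ℤ) :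
    lmom (s + s') n (f * g) =
      ∑ k ∈ range (n + 1), n.choose k * (lmom s k f * lmom s' (n - k) g) := by
  induction f using LaurentPolynomial.induction_on' with
  | add p q hp hq => simp only [add_mul, map_add, hp, hq, mul_add, Finset.sum_add_distrib]
  | C_mul_T m c =>
    induction g using LaurentPolynomial.induction_on' with
    | add p q hp hq => simp only [map_add, hp, hq, mul_add, Finset.sum_add_distrib]
    | C_mul_T m' c' =>
      have h : LaurentPolynomial.C c * T m * (LaurentPolynomial.C c' * T m') =
          LaurentPolynomial.C (c * c') * T (m + m') := by
        rw [LaurentPolynomial.T_add, map_mul]; ring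
      rw [h, lmom_C_mul_T, show 2 * (m + m') + (s + s') = 2 * m + s + (2 * m' + s') by ring,
        add_pow, Finset.mul_sum]
      refine Finset.sum_congr rfl fun k _ => ?_
      rw [lmom_C_mul_T, lmom_C_mul_T]
      ring

/-- The moments `∑ (2 m + s) ^ n f_m` of a series `∑ f_m z ^ m`. -/
noncomputable def mom (s : ℤ) (n : ℕ) : (LaurentPolynomial ℤ)⟦X⟧ →+ ℤ⟦X⟧ := cmap (lmom s n)

lemma mom_mul {s s' t : ℤ} (h : s + s' = t) (n : ℕ) (f g : (LaurentPolynomial ℤ)⟦X⟧) :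
    mom t n (f * g) = ∑ k ∈ range (n + 1),
        (n.choose k : ℤ⟦X⟧) * (mom s k f * mom s' (n - k) g) := by
  subst h
  ext N
  have hc : ∀ (k : ℕ) (x : ℤ⟦X⟧), coeff N ((n.choose k : ℤ⟦X⟧) * x) = n.choose k * coeff N x := by
    intro k x
    rw [← nsmul_eq_mul, map_nsmul, nsmul_eq_mul]
  simp only [mom, map_sum, coeff_cmap, coeff_mul, lmom_mul, hc]
  rw [Finset.sum_comm]
  simp only [Finset.mul_sum]

lemma mom_incl_mul (s : ℤ) (n : ℕ) (P : ℤ⟦X⟧) (f : (LaurentPolynomial ℤ)⟦X⟧) :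
    mom s n (incl P * f) = P * mom s n f := by
  rw [mom, cmap_incl_mul]
  congr 1

lemma mom_natCast_mul (s : ℤ) (n m : ℕ) (f : (LaurentPolynomial ℤ)⟦X⟧) :
    mom s n (m * f) = m * mom s n f := by
  rw [← nsmul_eq_mul, map_nsmul, nsmul_eq_mul]

lemma mom_intCast_mul (s : ℤ) (n : ℕ) (m : ℤ) (f : (LaurentPolynomial ℤ)⟦X⟧) :
    mom s n (m * f) = m * mom s n f := by
  rw [← zsmul_eq_mul, map_zsmul, zsmul_eq_mul]

lemma mom_dq (s : ℤ) (n : ℕ) (f : (LaurentPolynomial ℤ)⟦X⟧) :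
    mom s n (dq _ f) = dq _ (mom s n f) := by
  ext N
  rw [mom, coeff_cmap, coeff_dq, coeff_dq, coeff_cmap, ← nsmul_eq_mul, map_nsmul, nsmul_eq_mul]

lemma lmom_lder (s : ℤ) (n : ℕ) (f : LaurentPolynomial ℤ) :
    lmom s (n + 1) f = 2 * lmom s n (lder f) + s * lmom s n f := by
  have h : ∀ m c : ℤ, lder (LaurentPolynomial.C c * T m) = LaurentPolynomial.C (m * c) * T m := by
    intro m c
    ext i
    change i * (LaurentPolynomial.C c * T m).coeff i = _
    rw [← LaurentPolynomial.single_eq_C_mul_T, ← LaurentPolynomial.single_eq_C_mul_T,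
      AddMonoidAlgebra.coeff_single, AddMonoidAlgebra.coeff_single, Finsupp.single_apply,
      Finsupp.single_apply]
    split_ifs with h <;> simp [h]
  induction f using LaurentPolynomial.induction_on' with
  | add p q hp hq => simp only [map_add, hp, hq]; ring
  | C_mul_T m c => rw [h, lmom_C_mul_T, lmom_C_mul_T, lmom_C_mul_T]; ring

lemma mom_succ (s : ℤ) (n : ℕ) (f : (LaurentPolynomial ℤ)⟦X⟧) :
    mom s (n + 1) f = 2 * mom s n (dz f) + s * mom s n f := by
  ext N
  rw [two_mul, ← zsmul_eq_mul, map_add, map_add, map_zsmul, smul_eq_mul]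
  simp only [mom, dz, coeff_cmap]
  rw [lmom_lder]
  ring

lemma mom_zpw (s : ℤ) (n : ℕ) (k : ℤ) : mom s n (zpw k) = ((2 * k + s : ℤ) : ℤ⟦X⟧) ^ n := by
  ext N
  rw [mom, coeff_cmap, zpw, coeff_C, ← Int.cast_pow,
    show (((2 * k + s : ℤ) ^ n : ℤ) : ℤ⟦X⟧) = C ((2 * k + s) ^ n) by simp, coeff_C]
  split_ifs
  · exact lmom_T s n k
  · simp

lemma mom_one (s : ℤ) (n : ℕ) : mom s n 1 = (s : ℤ⟦X⟧) ^ n := by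
  rw [← zpw_zero, mom_zpw, mul_zero, zero_add]

lemma dsum_const_mul {R : Type*} [CommRing R] (e : ℕ → ℕ → ℕ) (c : R) (w : ℕ → ℕ → R) :
    dsum e (fun r i => c * w r i) = C c * dsum e w := by
  ext N
  simp only [coeff_C_mul, dsum, coeff_mk, Finset.mul_sum, mul_ite, mul_zero]

lemma mom_ell (n : ℕ) : mom 0 n ell = (2 - 2 * (-1) ^ n) * 2 ^ n * S ℤ n := by
  have h : (2 - 2 * (-1) ^ n) * 2 ^ n = (C ((2 - 2 * (-1) ^ n) * 2 ^ n : ℤ) : ℤ⟦X⟧) := by simp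
  rw [h, S, ← dsum_const_mul, mom, ell, cmap_dsum]
  congr 1
  ext r i
  rw [two_mul, map_add, map_sub, lmom_T, lmom_T, add_zero, add_zero, mul_neg,
    neg_pow (2 * ((i + 1 : ℕ) : ℤ)), mul_pow]
  push_cast
  ring

end Moments
end SptThirteen

namespace SptThirteen
open PowerSeries

section HeatMoments

lemma intCast_mul_left_cancel {c : ℤ} (hc : c ≠ 0) {f g : ℤ⟦X⟧} (h : (c : ℤ⟦X⟧) * f = c * g) :
    f = g := by
  ext n
  have := congrArg (coeff n) h
  rw [← zsmul_eq_mul, ← zsmul_eq_mul, map_zsmul, map_zsmul, smul_eq_mul, smul_eq_mul] at this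
  exact mul_left_cancel₀ hc this

/-- The left-hand side factor in `rho_eq`. -/
noncomputable def heat : (LaurentPolynomial ℤ)⟦X⟧ := 8 * rho - ell ^ 2 + 2 * dz ell

lemma dq_intCast_mul (m : ℤ) (f : ℤ⟦X⟧) : dq ℤ (m * f) = m * dq ℤ f := by
  rw [← zsmul_eq_mul, map_zsmul, zsmul_eq_mul]

lemma dq_mom_ell (n : ℕ) : dq ℤ (mom 0 n ell) = (2 - 2 * (-1) ^ n) * 2 ^ n * dq ℤ (S ℤ n) := by
  have := dq_intCast_mul ((2 - 2 * (-1) ^ n) * 2 ^ n) (S ℤ n)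
  push_cast at this
  rw [mom_ell, this]

lemma mom_heat_succ (m : ℕ) : mom 0 (m + 1) heat =
    -8 * ((2 - 2 * (-1) ^ m) * 2 ^ m * dq ℤ (S ℤ m)) -
    (∑ k ∈ range (m + 2), ((m + 1).choose k : ℤ⟦X⟧) * (mom 0 k ell * mom 0 (m + 1 - k) ell)) +
    mom 0 (m + 2) ell := by
  have h1 : mom 0 (m + 1) (8 * rho) = -8 * dq ℤ (mom 0 m ell) := by
    have h := congrArg (mom 0 m) two_mul_dz_rho
    have h8 := mom_natCast_mul 0 (m + 1) 8 rho
    have h2 := mom_natCast_mul 0 m 2 (dz rho)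
    have hs := mom_succ 0 m rho
    rw [map_neg, mom_dq] at h
    push_cast at h8 h2 hs
    linear_combination h8 + 8 * hs - 8 * h2 + 8 * h
  have h2 : mom 0 (m + 1) (2 * dz ell) = mom 0 (m + 2) ell := by
    have h2 := mom_natCast_mul 0 (m + 1) 2 (dz ell)
    have hs := mom_succ 0 (m + 1) ell
    push_cast at h2 hs
    linear_combination h2 - hs
  rw [heat, map_add, map_sub, h1, h2, sq, mom_mul (add_zero 0), dq_mom_ell]

lemma mom_one_sub_zpw (k : ℕ) : mom 1 k (1 - zpw (-1)) = 1 - (-1) ^ k := by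
  rw [map_sub, mom_one, mom_zpw]
  norm_num

lemma mom_one_add_zpw (k : ℕ) : mom 1 k (1 + zpw (-1)) = 1 + (-1) ^ k := by
  rw [map_add, mom_one, mom_zpw]
  norm_num

lemma sum_mom_heat (n : ℕ) :
    ∑ k ∈ range (n + 1), (n.choose k : ℤ⟦X⟧) * ((1 - (-1) ^ k) * mom 0 (n - k) heat) =
      -2 * ∑ k ∈ range (n + 1), (n.choose k : ℤ⟦X⟧) * ((1 + (-1) ^ k) * mom 0 (n - k) ell) := by
  have h := congrArg (mom 1 n) rho_eq
  have h' := mom_intCast_mul 1 n (-2) ((1 + zpw (-1)) * ell)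
  rw [← heat, mom_mul (add_zero 1), mul_assoc] at h
  push_cast at h'
  rw [h', mom_mul (add_zero 1)] at h
  simpa only [mom_one_sub_zpw, mom_one_add_zpw] using h

lemma dq_S_1 : 6 * dq ℤ (S ℤ 1) =
    -12 * S ℤ 1 ^ 2 + S ℤ 1 + 5 * S ℤ 3 := by
  have h1 := sum_mom_heat 1
  have h3 := sum_mom_heat 3
  have y := mom_heat_succ 1
  norm_num [sum_range_succ, Nat.choose, mom_ell, -Derivation.leibniz] at h1 h3 y
  refine intCast_mul_left_cancel (c := 64) (by norm_num) ?_
  push_cast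
  linear_combination 6 * y + 1 * h1 - 1 * h3

lemma dq_S_3 : 30 * dq ℤ (S ℤ 3) =
    -240 * S ℤ 1 * S ℤ 3 - S ℤ 1 + 10 * S ℤ 3 + 21 * S ℤ 5 := by
  have h1 := sum_mom_heat 1
  have h3 := sum_mom_heat 3
  have h5 := sum_mom_heat 5
  have y := mom_heat_succ 3
  norm_num [sum_range_succ, Nat.choose, mom_ell, -Derivation.leibniz] at h1 h3 h5 y
  refine intCast_mul_left_cancel (c := 256) (by norm_num) ?_
  push_cast
  linear_combination 30 * y - 7 * h1 + 10 * h3 - 3 * h5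

lemma dq_S_5 : 42 * dq ℤ (S ℤ 5) =
    -504 * S ℤ 1 * S ℤ 5 - 840 * S ℤ 3 ^ 2 + S ℤ 1 - 7 * S ℤ 3 + 21 * S ℤ 5 + 27 * S ℤ 7 := by
  have h1 := sum_mom_heat 1
  have h3 := sum_mom_heat 3
  have h5 := sum_mom_heat 5
  have h7 := sum_mom_heat 7
  have y := mom_heat_succ 5
  norm_num [sum_range_succ, Nat.choose, mom_ell, -Derivation.leibniz] at h1 h3 h5 h7 y
  refine intCast_mul_left_cancel (c := 1024) (by norm_num) ?_
  push_cast
  linear_combination 42 * y + 31 * h1 - 49 * h3 + 21 * h5 - 3 * h7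

lemma dq_S_7 : 90 * dq ℤ (S ℤ 7) =
    -1440 * S ℤ 1 * S ℤ 7 - 10080 * S ℤ 3 * S ℤ 5 - 3 * S ℤ 1 + 20 * S ℤ 3 - 42 * S ℤ 5 + 60 *
    S ℤ 7 + 55 * S ℤ 9 := by
  have h1 := sum_mom_heat 1
  have h3 := sum_mom_heat 3
  have h5 := sum_mom_heat 5
  have h7 := sum_mom_heat 7
  have h9 := sum_mom_heat 9
  have y := mom_heat_succ 7
  norm_num [sum_range_succ, Nat.choose, mom_ell, -Derivation.leibniz] at h1 h3 h5 h7 h9 y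
  refine intCast_mul_left_cancel (c := 4096) (by norm_num) ?_
  push_cast
  linear_combination 90 * y - 381 * h1 + 620 * h3 - 294 * h5 + 60 * h7 - 5 * h9

lemma dq_S_9 : 66 * dq ℤ (S ℤ 9) =
    -1320 * S ℤ 1 * S ℤ 9 - 15840 * S ℤ 3 * S ℤ 7 - 16632 * S ℤ 5 ^ 2 + 5 * S ℤ 1 - 33 * S ℤ 3
    + 66 * S ℤ 5 - 66 * S ℤ 7 + 55 * S ℤ 9 + 39 * S ℤ 11 := by
  have h1 := sum_mom_heat 1
  have h3 := sum_mom_heat 3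
  have h5 := sum_mom_heat 5
  have h7 := sum_mom_heat 7
  have h9 := sum_mom_heat 9
  have h11 := sum_mom_heat 11
  have y := mom_heat_succ 9
  norm_num [sum_range_succ, Nat.choose, mom_ell, -Derivation.leibniz] at h1 h3 h5 h7 h9 h11 y
  refine intCast_mul_left_cancel (c := 16384) (by norm_num) ?_
  push_cast
  linear_combination 66 * y + 2555 * h1 - 4191 * h3 + 2046 * h5 - 462 * h7 + 55 * h9 - 3 * h11

lemma dq_S_11 : 2730 * dq ℤ (S ℤ 11) =
    -65520 * S ℤ 1 * S ℤ 11 - 1201200 * S ℤ 3 * S ℤ 9 - 4324320 * S ℤ 5 * S ℤ 7 - 691 * S ℤ 1 +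
    4550 * S ℤ 3 - 9009 * S ℤ 5 + 8580 * S ℤ 7 - 5005 * S ℤ 9 + 2730 * S ℤ 11 + 1575 * S ℤ 13 := by
  have h1 := sum_mom_heat 1
  have h3 := sum_mom_heat 3
  have h5 := sum_mom_heat 5
  have h7 := sum_mom_heat 7
  have h9 := sum_mom_heat 9
  have h11 := sum_mom_heat 11
  have h13 := sum_mom_heat 13
  have y := mom_heat_succ 11
  norm_num [sum_range_succ, Nat.choose, mom_ell, -Derivation.leibniz] at h1 h3 h5 h7 h9 h11 h13 y
  refine intCast_mul_left_cancel (c := 65536) (by norm_num) ?_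
  push_cast
  linear_combination 2730 * y - 1414477 * h1 + 2325050 * h3 - 1144143 * h5 + 265980 * h7 - 35035 * h9 + 2730 *
    h11 - 105 * h13

end HeatMoments
end SptThirteen

namespace SptThirteen
open PowerSeries

section PartialTheta

open LaurentPolynomial (T)

/-- The partial theta function `∑ (-1)^n q^(n (3 n + 1) / 2 + n i)`. -/
noncomputable def phi (i : ℕ) : ℤ⟦X⟧ := rsum (fun n => pent n + n + n * i) (fun n => (-1) ^ n)

lemma le_phiExp (i n : ℕ) : n ≤ pent n + n + n * i := by omega

lemma phi_eq (i : ℕ) : phi i = 1 + rsum (fun n => aexp n i) (fun n => (-1) ^ (n + 1)) := by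
  rw [phi, rsum_eq_add (le_phiExp i)]
  simp [pent, aexp]

lemma X_pow_mul_phi (i : ℕ) : X ^ (i + 2) * phi (i + 3) = 1 - phi i := by
  rw [phi, X_pow_mul_rsum (le_phiExp _), phi_eq]
  have h : (fun n => i + 2 + (pent n + n + n * (i + 3))) = fun n => aexp n i := by
    ext n
    rw [aexp, pent_succ]
    ring
  have h2 : (fun n => (-1) ^ (n + 1) : ℕ → ℤ) = fun n => -(-1) ^ n := by
    ext n
    ring
  rw [h, h2, rsum_neg]
  ring

lemma natCast_pent_mul_two (n : ℕ) : 2 * (pent n : ℤ) = n * (3 * n - 1) := by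
  induction n with
  | zero => simp [pent]
  | succ n ih => rw [pent_succ]; push_cast; linarith

lemma pentagonal_neg_natCast (n : ℕ) : pentagonal (-n) = pent n + n := by
  have h1 := two_mul_natCast_pentagonal_neg n
  have h2 := natCast_pent_mul_two n
  zify
  linarith

lemma pentagonal_natCast (n : ℕ) : pentagonal n = pent n := by
  have h1 := two_mul_natCast_pentagonal n
  have h2 := natCast_pent_mul_two n
  zify
  linarith

lemma pentagonalSeries_eq_add : pentagonalSeries ℤ =
    phi 0 + rsum (fun n => pent (n + 1)) (fun n => (-1) ^ (n + 1)) := by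
  have he : ∀ n, n ≤ pent (n + 1) := fun n => by
    have := le_pent (n + 1)
    omega
  ext N
  rw [map_add, phi, coeff_rsum (le_phiExp 0) _ (Nat.lt_succ_self N),
    coeff_rsum he _ (Nat.lt_succ_self N)]
  have h1 : ∀ n : ℕ, pent n + n + n * 0 = pentagonal (-n) := fun n => by
    rw [pentagonal_neg_natCast, mul_zero, add_zero]
  simp only [h1]
  simp only [← pentagonal_natCast]
  by_cases hN : N ∈ Set.range pentagonal
  · obtain ⟨k, rfl⟩ := hN
    rw [coeff_pentagonalSeries_pentagonal]
    simp only [pentagonal_inj]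
    rcases le_or_gt k 0 with hk | hk
    · obtain ⟨n, rfl⟩ : ∃ n : ℕ, k = -n := ⟨k.natAbs, by omega⟩
      rw [Finset.sum_eq_single n, Finset.sum_eq_zero]
      · simp
      · intro m _
        rw [if_neg (by push_cast; omega)]
      · intro m _ hm
        rw [if_neg (by omega)]
      · intro h
        rw [pentagonal_neg_natCast, Finset.mem_range] at h
        omega
    · obtain ⟨n, rfl⟩ : ∃ n : ℕ, k = (n + 1 : ℕ) := ⟨(k - 1).toNat, by omega⟩
      rw [Finset.sum_eq_zero, Finset.sum_eq_single n]
      · rw [if_pos rfl, zero_add, Int.coe_negOnePow_natCast]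
        simp
      · intro m _ hm
        rw [if_neg (by omega)]
      · intro h
        rw [pentagonal_natCast, Finset.mem_range] at h
        have := he n
        omega
      · intro m _
        rw [if_neg (by push_cast; omega)]
  · rw [coeff_pentagonalSeries_eq_zero ℤ hN, Finset.sum_eq_zero, Finset.sum_eq_zero, add_zero] <;>
    · intro n _
      rw [if_neg]
      rintro rfl
      exact hN ⟨_, rfl⟩

lemma X_mul_phi_two : X * phi 2 = phi 0 - pentagonalSeries ℤ := by
  rw [pentagonalSeries_eq_add]
  have h := X_pow_mul_rsum (R := ℤ) (le_phiExp 2) (fun n => (-1) ^ n) 1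
  have h2 : (fun n => 1 + (pent n + n + n * 2)) = fun n => pent (n + 1) := by
    ext n
    rw [pent_succ]
    ring
  have h3 : (fun n => (-1) ^ (n + 1) : ℕ → ℤ) = fun n => -(-1) ^ n := by
    ext n
    ring
  rw [pow_one, ← phi, h2] at h
  rw [h, h3, rsum_neg]
  ring

/-- The two-variable series whose moments are the series `A`. -/
noncomputable def gser : (LaurentPolynomial ℤ)⟦X⟧ :=
  dsum aexp fun r i => (-1) ^ (r + 1) * (T ((i + 2 : ℕ) : ℤ) - T (1 - (i : ℤ)))

lemma map_neg_one_pow_mul {R : Type*} [CommRing R] (φ : LaurentPolynomial ℤ →+ R) (r : ℕ)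
    (f : LaurentPolynomial ℤ) : φ ((-1) ^ (r + 1) * f) = (-1) ^ (r + 1) * φ f := by
  have h : (-1) ^ (r + 1) * f = ((-1) ^ (r + 1) : ℤ) • f := by rw [zsmul_eq_mul]; push_cast; rfl
  rw [h, map_zsmul, zsmul_eq_mul]
  push_cast
  rfl

/-- The rows of `gser` corrected by its principal part. -/
noncomputable def gFull (m : ℤ) : ℤ⟦X⟧ := row gser m + if 2 ≤ m then 1 else 0

lemma gFull_natCast (i : ℕ) : gFull (i + 2 : ℕ) = phi i := by
  rw [gFull, phi_eq, if_pos (by omega), add_comm, row, gser, cmap_dsum,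
    ← dsum_ite (e := aexp) aexp_le i]
  congr 2
  ext r j
  rw [map_neg_one_pow_mul, map_sub, lcoeff_T, lcoeff_T]
  by_cases h : j = i
  · subst h
    rw [if_pos rfl, if_pos rfl, if_neg (by omega), sub_zero, mul_one]
  · rw [if_neg (by omega), if_neg (by omega), if_neg h, sub_zero, mul_zero]

lemma row_gser_symm (m : ℤ) : row gser (3 - m) = -row gser m := by
  ext n
  rw [row, row, gser, cmap_dsum, cmap_dsum, map_neg, dsum, dsum, coeff_mk, coeff_mk,
    ← Finset.sum_neg_distrib]
  refine Finset.sum_congr rfl fun r _ => ?_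
  rw [← Finset.sum_neg_distrib]
  refine Finset.sum_congr rfl fun i _ => ?_
  rw [map_neg_one_pow_mul, map_neg_one_pow_mul, map_sub, map_sub, lcoeff_T, lcoeff_T, lcoeff_T,
      lcoeff_T]
  simp only [show (3 - m = ((i + 2 : ℕ) : ℤ)) = (m = 1 - (i : ℤ)) from propext (by omega),
    show (3 - m = 1 - (i : ℤ)) = (m = ((i + 2 : ℕ) : ℤ)) from propext (by omega)]
  split_ifs <;> simp

lemma gFull_symm (m : ℤ) : gFull (3 - m) = 1 - gFull m := by
  rw [gFull, gFull, row_gser_symm]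
  split_ifs <;> first | omega | ring

end PartialTheta
end SptThirteen

namespace SptThirteen
open PowerSeries

section ThetaConvolution

lemma dq_X_pow_mul (m : ℕ) (f : ℤ⟦X⟧) :
    dq ℤ (X ^ m * f) = (m : ℤ⟦X⟧) * (X ^ m * f) + X ^ m * dq ℤ f := by
  rw [dq_mul, dq_X_pow]
  ring

/-- The polynomial `(2 m - 3) ^ 2 - P`, with `P = 1 - 24 S 1`. -/
noncomputable def cpoly (m : ℤ) : ℤ⟦X⟧ := ((2 * m - 3 : ℤ) : ℤ⟦X⟧) ^ 2 - (1 - 24 * S ℤ 1)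

lemma cpoly_symm (m : ℤ) : cpoly (3 - m) = cpoly m := by
  rw [cpoly, cpoly]
  push_cast
  ring

/-- The operator `24 D + (2 m - 3) ^ 2 - P`. -/
noncomputable def heatOp (m : ℤ) (f : ℤ⟦X⟧) : ℤ⟦X⟧ := 24 * dq ℤ f + cpoly m * f

lemma heatOp_one_sub (m : ℤ) (f : ℤ⟦X⟧) : heatOp m (1 - f) = cpoly m - heatOp m f := by
  rw [heatOp, heatOp, map_sub, Derivation.map_one_eq_zero]
  ring

lemma X_pow_mul_heatOp (m : ℕ) (f : ℤ⟦X⟧) :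
    X ^ m * heatOp (m + 3) f = heatOp m (X ^ m * f) := by
  rw [heatOp, heatOp, dq_X_pow_mul, cpoly, cpoly]
  push_cast
  ring

lemma heatOp_sub (m : ℤ) (f g : ℤ⟦X⟧) : heatOp m (f - g) = heatOp m f - heatOp m g := by
  rw [heatOp, heatOp, heatOp, map_sub]
  ring

lemma heatOp_one_pentagonalSeries : heatOp 1 (pentagonalSeries ℤ) = 0 := by
  rw [heatOp, dq_pentagonalSeries, cpoly]
  push_cast
  ring

/-- The rows `(24 D + (2 m - 3) ^ 2 - P) gFull m`. -/
noncomputable def hFull (m : ℤ) : ℤ⟦X⟧ := heatOp m (gFull m)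

lemma hFull_symm (m : ℤ) : hFull (3 - m) = cpoly m - hFull m := by
  rw [hFull, gFull_symm, heatOp_one_sub, cpoly_symm, heatOp, cpoly_symm]
  rfl

lemma X_pow_mul_hFull (m : ℕ) : X ^ m * hFull (m + 3) = cpoly m - hFull m := by
  rw [hFull, X_pow_mul_heatOp, hFull, ← heatOp_one_sub]
  match m with
  | 0 =>
    have := gFull_symm 0
    rw [sub_zero] at this
    simp [this]
  | 1 =>
    have h0 := gFull_symm 1
    have h1 := gFull_natCast 0
    have h2 := gFull_natCast 2
    norm_num at h0 h1 h2
    norm_num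
    rw [← h0, h1, h2, X_mul_phi_two, heatOp_sub, heatOp_one_pentagonalSeries, sub_zero]
  | m + 2 =>
    have h := gFull_natCast (m + 3)
    have h2 : ((m + 2 : ℕ) : ℤ) + 3 = (m + 3 + 2 : ℕ) := by push_cast; ring
    rw [gFull_natCast, h2, h, X_pow_mul_phi]

lemma zc_hFull_shift (b m : ℤ) :
    zc (b + m + -3) (hFull (m + -3) - cpoly (m + -3)) = zc b (-hFull m) := by
  obtain ⟨k, rfl⟩ : ∃ k, m = k + 3 := ⟨m - 3, by ring⟩
  rw [show k + 3 + -3 = k by ring, show b + (k + 3) + -3 = b + k by ring]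
  obtain ⟨n, rfl | rfl⟩ := k.eq_nat_or_neg
  · rw [← neg_sub, ← X_pow_mul_hFull, zc_neg, zc_neg, zc_X_pow_mul]
  · have h1 := hFull_symm n
    have h2 := hFull_symm (-n)
    rw [← X_pow_mul_hFull] at h1
    rw [← neg_sub, ← h2, neg_add_eq_sub, h1, zc_neg, zc_neg, ← zc_X_pow_mul (b + -n) n,
      neg_add_cancel_right, sub_neg_eq_add, add_comm 3]

lemma zc_mul_shift {f g : (LaurentPolynomial ℤ)⟦X⟧} {ε ε' w v : ℤ}
    (hf : ∀ a i, zc (a + i + w) (row f (i + w)) = ε * zc a (row f i))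
    (hg : ∀ a i, zc (a + i + v) (row g (i + v)) = ε' * zc a (row g i)) (a i : ℤ) :
    zc (a + i + (w + v)) (row (f * g) (i + (w + v))) = ε * ε' * zc a (row (f * g) i) := by
  rw [← conv_row, ← conv_row, ← add_assoc, ← add_assoc,
    conv_shift (g' := fun m => (ε' : ℤ⟦X⟧) * row g m) hf
      (fun b m => (hg b m).trans (zc_intCast_mul _ _ _).symm), mul_assoc]
  congr 1
  rw [conv, conv, ← smul_eq_mul, smul_finsum]
  refine finsum_congr fun p => ?_
  rw [zc_intCast_mul, smul_eq_mul]
  ring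

lemma zc_theta_pow_three_shift (a i : ℤ) :
    zc (a + i + 3) (row (theta ^ 3) (i + 3)) = -1 * zc a (row (theta ^ 3) i) := by
  have := zc_mul_shift (zc_mul_shift zc_theta_shift zc_theta_shift) zc_theta_shift a i
  norm_num [← sq, ← pow_succ] at this
  rw [this, neg_one_mul]

/-- The image of `gser` under the operator with symbol `24 D + (2 m - 3) ^ 2 - P`. -/
noncomputable def heatSeries : (LaurentPolynomial ℤ)⟦X⟧ :=
  24 * dq _ gser + (4 * dz (dz gser) - 12 * dz gser + 9 * gser) - incl (1 - 24 * S ℤ 1) * gser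

lemma row_natCast_mul (n : ℕ) (f : (LaurentPolynomial ℤ)⟦X⟧) (m : ℤ) :
    row (n * f) m = n * row f m := by
  rw [row, row, ← nsmul_eq_mul, map_nsmul, nsmul_eq_mul]

lemma row_heatSeries (m : ℤ) : row heatSeries m = heatOp m (row gser m) := by
  have h1 := row_natCast_mul 24 (dq _ gser) m
  have h2 := row_natCast_mul 4 (dz (dz gser)) m
  have h3 := row_natCast_mul 12 (dz gser) m
  have h4 := row_natCast_mul 9 gser m
  push_cast at h1 h2 h3 h4
  rw [heatSeries, row_sub, row_add, row_add, row_sub, h1, h2, h3, h4, row_incl_mul, row_dz, row_dz,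
    row_dq, heatOp, cpoly]
  push_cast
  ring

lemma hFull_eq (m : ℤ) : hFull m = row heatSeries m + if 2 ≤ m then cpoly m else 0 := by
  rw [hFull, gFull, row_heatSeries, heatOp, heatOp, map_add]
  split_ifs
  · rw [Derivation.map_one_eq_zero]; ring
  · rw [map_zero]; ring

/-- The theta quotient `8 + 24 S₁ (z - 2 + z⁻¹) - (1 - z⁻¹)³ heatSeries`. -/
noncomputable def hser : (LaurentPolynomial ℤ)⟦X⟧ :=
  8 + 24 * (incl (S ℤ 1) * (zpw 1 - 2 + zpw (-1))) - (1 - zpw (-1)) ^ 3 * heatSeries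

lemma row_one_sub_zpw_pow_three_mul (f : (LaurentPolynomial ℤ)⟦X⟧) (m : ℤ) :
    row ((1 - zpw (-1)) ^ 3 * f) m =
      row f m - 3 * row f (m + 1) + 3 * row f (m + 2) - row f (m + 3) := by
  have h : ∀ (g : (LaurentPolynomial ℤ)⟦X⟧) (m : ℤ),
      row ((1 - zpw (-1)) * g) m = row g m - row g (m + 1) := fun g m => by
    rw [sub_mul, one_mul, row_sub, row_zpw_mul, sub_neg_eq_add]
  rw [pow_succ, sq, mul_assoc, mul_assoc]
  simp only [h, add_assoc]
  norm_num
  ring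

lemma row_hser (m : ℤ) : row hser m =
    -(hFull m - 3 * hFull (m + 1) + 3 * hFull (m + 2) - hFull (m + 3)) := by
  have h8 := row_natCast_mul 8 1 m
  have h24 := row_natCast_mul 24 (incl (S ℤ 1) * (zpw 1 - 2 + zpw (-1))) m
  have h2 := row_natCast_mul 2 1 m
  push_cast at h8 h24 h2
  rw [mul_one] at h8 h2
  rw [hser, row_sub, row_add, h8, h24, row_incl_mul, row_add, row_sub, h2, row_zpw, row_zpw,
      row_one,
    row_one_sub_zpw_pow_three_mul, hFull_eq, hFull_eq, hFull_eq, hFull_eq]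
  rcases lt_trichotomy m 0 with h | rfl | h
  · rcases (show m = -1 ∨ m ≤ -2 by omega) with rfl | h
    · norm_num [cpoly]
      ring
    · rw [if_neg (by omega), if_neg (by omega), if_neg (by omega), if_neg (by omega),
        if_neg (by omega), if_neg (by omega), if_neg (by omega)]
      ring
  · norm_num [cpoly]
    ring
  · rcases (show m = 1 ∨ 2 ≤ m by omega) with rfl | h
    · norm_num [cpoly]
      ring
    · rw [if_neg (by omega), if_neg (by omega), if_neg (by omega), if_pos (by omega),
        if_pos (by omega), if_pos (by omega), if_pos (by omega), cpoly, cpoly, cpoly, cpoly]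
      push_cast
      ring

lemma conv_theta_pow_three (g : ℤ → ℤ⟦X⟧) : conv (theta ^ 3) g =
    conv (tau ^ 3) fun m => g m - 3 * g (m + 1) + 3 * g (m + 2) - g (m + 3) := by
  have h : theta ^ 3 = (1 - zpw (-1)) * ((1 - zpw (-1)) * ((1 - zpw (-1)) * tau ^ 3)) := by
    rw [theta]
    ring
  rw [h, conv_one_sub_zpw_mul, conv_one_sub_zpw_mul, conv_one_sub_zpw_mul]
  congr 1
  ext1 m
  ring_nf

lemma conv_theta_pow_three_cpoly (N j : ℤ) : conv (theta ^ 3) cpoly N j = 0 := by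
  have h : (fun m => cpoly m - 3 * cpoly (m + 1) + 3 * cpoly (m + 2) - cpoly (m + 3)) =
      fun _ => 0 := by
    ext1 m
    simp only [cpoly]
    push_cast
    ring
  rw [conv_theta_pow_three, h]
  simp [conv, zc_zero]

lemma conv_theta_pow_three_hFull_add (N j : ℤ) :
    conv (theta ^ 3) hFull (N + j) j = conv (theta ^ 3) hFull N j := by
  have h := conv_shift (g := fun m => hFull m - cpoly m) (g' := fun m => -hFull m)
    zc_theta_pow_three_shift zc_hFull_shift N j
  rw [conv_sub, conv_neg, add_neg_cancel_right, add_neg_cancel_right,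
      conv_theta_pow_three_cpoly] at h
  linarith

lemma conv_theta_pow_three_hFull (N : ℤ) {j : ℤ} (hj : j ≠ 0) : conv (theta ^ 3) hFull N j = 0 := by
  have h : ∀ k : ℕ, conv (theta ^ 3) hFull N j = conv (theta ^ 3) hFull (N - k * |j|) j := by
    intro k
    induction k with
    | zero => simp
    | succ k ih =>
      rw [ih]
      rcases abs_choice j with h | h <;> rw [h]
      · rw [← conv_theta_pow_three_hFull_add (N - (k + 1 : ℕ) * j)]
        congr 1
        push_cast
        ring
      · rw [← conv_theta_pow_three_hFull_add]
        congr 1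
        push_cast
        ring
  rw [h (N.natAbs + 1)]
  refine conv_of_neg _ _ ?_ _
  have h1 : 0 < |j| := abs_pos.2 hj
  push_cast
  nlinarith [abs_nonneg N, le_abs_self N]

lemma row_tau_pow_three_mul_hser {j : ℤ} (hj : j ≠ 0) : row (tau ^ 3 * hser) j = 0 := by
  refine zc_ext fun N => ?_
  have h := conv_theta_pow_three_hFull N hj
  have h1 : (fun m => hFull m - 3 * hFull (m + 1) + 3 * hFull (m + 2) - hFull (m + 3)) =
      fun m => -row hser m := by
    ext1 m
    rw [row_hser, neg_neg]
  rw [conv_theta_pow_three, h1, conv_neg, conv_row, neg_eq_zero] at h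
  rw [h, zc_zero]

lemma two_mul_dz_hser : 2 * dz hser = 3 * ell * hser := by
  have h : dz (tau ^ 3 * hser) = 0 := by
    refine row_ext fun m => ?_
    rw [row_dz]
    have h0 : row 0 m = 0 := by rw [← sub_self 1, row_sub, sub_self]
    by_cases hm : m = 0
    · rw [hm, Int.cast_zero, zero_mul, ← hm, h0]
    · rw [row_tau_pow_three_mul_hser hm, mul_zero, h0]
  have h3 : dz (tau ^ 3) = 3 * tau ^ 2 * dz tau := by
    rw [pow_succ, sq, dz_mul, dz_mul]
    ring
  rw [dz_mul, h3] at h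
  refine mul_left_cancel₀ (pow_ne_zero 3 tau_ne_zero) ?_
  linear_combination 2 * h - 3 * tau ^ 2 * hser * two_mul_dz_tau

end ThetaConvolution
end SptThirteen

namespace SptThirteen
open PowerSeries

section SptMoments

open LaurentPolynomial (T)

/-- The combination `(24 D - P) A_n + A_{n+2}`, where `P = 1 - 24 S₁`. -/
noncomputable def Bser (n : ℕ) : ℤ⟦X⟧ :=
  24 * dq ℤ (A ℤ n) + A ℤ (n + 2) - (1 - 24 * S ℤ 1) * A ℤ n

lemma mom_gser (n : ℕ) : mom (-3) n gser = ((1 - (-1) ^ n : ℤ) : ℤ⟦X⟧) * A ℤ n := by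
  have h : ((1 - (-1) ^ n : ℤ) : ℤ⟦X⟧) = C (1 - (-1) ^ n : ℤ) := by simp
  rw [h, A, ← dsum_const_mul, mom, gser, cmap_dsum]
  congr 1
  ext r i
  rw [map_neg_one_pow_mul, map_sub, lmom_T, lmom_T,
    show 2 * (1 - (i : ℤ)) + -3 = -(2 * i + 1) by ring, neg_pow (2 * (i : ℤ) + 1)]
  push_cast
  ring

lemma mom_heatSeries (n : ℕ) :
    mom (-3) n heatSeries = ((1 - (-1) ^ n : ℤ) : ℤ⟦X⟧) * Bser n := by
  have h1 := mom_natCast_mul (-3) n 24 (dq _ gser)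
  have h2 := mom_natCast_mul (-3) n 4 (dz (dz gser))
  have h3 := mom_natCast_mul (-3) n 12 (dz gser)
  have h4 := mom_natCast_mul (-3) n 9 gser
  have h5 := mom_succ (-3) n (dz gser)
  have h6 := mom_succ (-3) (n + 1) gser
  have h7 := mom_succ (-3) n gser
  have h8 := mom_gser (n + 2)
  have h0 := mom_gser n
  have h9 := dq_intCast_mul (1 - (-1) ^ n) (A ℤ n)
  rw [pow_add, neg_one_sq, mul_one] at h8
  push_cast at h0 h1 h2 h3 h4 h5 h6 h7 h8 h9
  rw [heatSeries, map_sub, map_add, map_add, map_sub, h1, h2, h3, h4, mom_incl_mul, mom_dq,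
    mom_gser, Bser]
  push_cast
  rw [h9]
  linear_combination h8 - 2 * h5 - h6 + 3 * h7 - 9 * h0

lemma mom_one_sub_zpw_pow_three (n : ℕ) : mom 3 n ((1 - zpw (-1)) ^ 3) =
    ((3 ^ n - 3 + 3 * (-1) ^ n - (-3) ^ n : ℤ) : ℤ⟦X⟧) := by
  have h : (1 - zpw (-1)) ^ 3 =
      1 - (3 : ℕ) * zpw (-1) + (3 : ℕ) * zpw (-2) - zpw (-3) := by
    have h2 : zpw (-2) = zpw (-1) * zpw (-1) := (zpw_add (-1) (-1)).symm ▸ rfl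
    have h3 : zpw (-3) = zpw (-1) * zpw (-2) := (zpw_add (-1) (-2)).symm ▸ rfl
    rw [h3, h2]
    push_cast
    ring
  rw [h, map_sub, map_add, map_sub, mom_natCast_mul, mom_natCast_mul, mom_one, mom_zpw, mom_zpw,
    mom_zpw]
  norm_num

lemma mom_hser (n : ℕ) : mom 0 n hser =
    8 * 0 ^ n + 24 * (S ℤ 1 * (2 ^ n - 2 * 0 ^ n + (-2) ^ n)) -
      ∑ k ∈ range (n + 1), (n.choose k : ℤ⟦X⟧) *
        (((3 ^ k - 3 + 3 * (-1) ^ k - (-3) ^ k : ℤ) : ℤ⟦X⟧) *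
          (((1 - (-1) ^ (n - k) : ℤ) : ℤ⟦X⟧) * Bser (n - k))) := by
  have h8 := mom_natCast_mul 0 n 8 1
  have h2 := mom_natCast_mul 0 n 2 1
  have h24 := mom_natCast_mul 0 n 24 (incl (S ℤ 1) * (zpw 1 - 2 + zpw (-1)))
  push_cast at h8 h2 h24
  rw [mul_one] at h8 h2
  rw [hser, map_sub, map_add, h8, h24, mom_incl_mul, map_add, map_sub, h2, mom_one, mom_zpw,
      mom_zpw,
    mom_mul (show (3 : ℤ) + -3 = 0 by norm_num)]
  simp only [mom_one_sub_zpw_pow_three, mom_heatSeries]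
  push_cast
  norm_num

lemma mom_hser_succ (n : ℕ) : mom 0 (n + 1) hser =
    3 * ∑ k ∈ range (n + 1), (n.choose k : ℤ⟦X⟧) * (mom 0 k ell * mom 0 (n - k) hser) := by
  have h := congrArg (mom 0 n) two_mul_dz_hser
  have h2 := mom_natCast_mul 0 n 2 (dz hser)
  have h3 := mom_natCast_mul 0 n 3 (ell * hser)
  push_cast at h2 h3
  rw [h2, mul_assoc, h3, mom_mul (add_zero 0)] at h
  rw [mom_succ, h, Int.cast_zero, zero_mul, add_zero]

lemma mom_hser_zero : mom 0 0 hser = 8 := by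
  rw [mom_hser]
  norm_num

lemma mom_hser_2 : mom 0 2 hser =
    192 * S ℤ 1 := by
  have h := mom_hser_succ 1
  norm_num [sum_range_succ, Nat.choose, mom_ell, mom_hser_zero] at h
  rw [h]
  ring

lemma mom_hser_4 : mom 0 4 hser =
    13824 * S ℤ 1 ^ 2 + 768 * S ℤ 3 := by
  have h := mom_hser_succ 3
  norm_num [sum_range_succ, Nat.choose, mom_ell, mom_hser_zero, mom_hser_2] at h
  rw [h]
  ring

lemma mom_hser_6 : mom 0 6 hser =
    1658880 * S ℤ 1 ^ 3 + 276480 * S ℤ 1 * S ℤ 3 + 3072 * S ℤ 5 := by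
  have h := mom_hser_succ 5
  norm_num [sum_range_succ, Nat.choose, mom_ell, mom_hser_zero, mom_hser_2, mom_hser_4] at h
  rw [h]
  ring

lemma mom_hser_8 : mom 0 8 hser =
    278691840 * S ℤ 1 ^ 4 + 92897280 * S ℤ 1 ^ 2 * S ℤ 3 + 2064384 * S ℤ 1 * S ℤ 5 + 2580480 *
    S ℤ 3 ^ 2 + 12288 * S ℤ 7 := by
  have h := mom_hser_succ 7
  norm_num [sum_range_succ, Nat.choose, mom_ell, mom_hser_zero, mom_hser_2, mom_hser_4,
      mom_hser_6] at h
  rw [h]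
  ring

lemma mom_hser_10 : mom 0 10 hser =
    60197437440 * S ℤ 1 ^ 5 + 33443020800 * S ℤ 1 ^ 3 * S ℤ 3 + 1114767360 * S ℤ 1 ^ 2 * S ℤ 5
    + 2786918400 * S ℤ 1 * S ℤ 3 ^ 2 + 13271040 * S ℤ 1 * S ℤ 7 + 61931520 * S ℤ 3 * S ℤ 5 +
    49152 * S ℤ 9 := by
  have h := mom_hser_succ 9
  norm_num [sum_range_succ, Nat.choose, mom_ell, mom_hser_zero, mom_hser_2, mom_hser_4,
      mom_hser_6, mom_hser_8] at h
  rw [h]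
  ring

lemma mom_hser_12 : mom 0 12 hser =
    15892123484160 * S ℤ 1 ^ 6 + 13243436236800 * S ℤ 1 ^ 4 * S ℤ 3 + 588597166080 * S ℤ 1 ^ 3
    * S ℤ 5 + 2207239372800 * S ℤ 1 ^ 2 * S ℤ 3 ^ 2 + 10510663680 * S ℤ 1 ^ 2 * S ℤ 7 +
    98099527680 * S ℤ 1 * S ℤ 3 * S ℤ 5 + 40874803200 * S ℤ 3 ^ 3 + 77856768 * S ℤ 1 * S ℤ 9 +
    583925760 * S ℤ 3 * S ℤ 7 + 544997376 * S ℤ 5 ^ 2 + 196608 * S ℤ 11 := by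
  have h := mom_hser_succ 11
  norm_num [sum_range_succ, Nat.choose, mom_ell, mom_hser_zero, mom_hser_2, mom_hser_4,
      mom_hser_6, mom_hser_8, mom_hser_10] at h
  rw [h]
  ring

lemma mom_hser_14 : mom 0 14 hser =
    4958342527057920 * S ℤ 1 ^ 7 + 5784732948234240 * S ℤ 1 ^ 5 * S ℤ 3 + 321374052679680 * S ℤ
    1 ^ 4 * S ℤ 5 + 1606870263398400 * S ℤ 1 ^ 3 * S ℤ 3 ^ 2 + 7651763159040 * S ℤ 1 ^ 3 * S ℤ
    7 + 107124684226560 * S ℤ 1 ^ 2 * S ℤ 3 * S ℤ 5 + 89270570188800 * S ℤ 1 * S ℤ 3 ^ 3 +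
    85019590656 * S ℤ 1 ^ 2 * S ℤ 9 + 1275293859840 * S ℤ 1 * S ℤ 3 * S ℤ 7 + 1190274269184 * S
    ℤ 1 * S ℤ 5 ^ 2 + 2975685672960 * S ℤ 3 ^ 2 * S ℤ 5 + 429391872 * S ℤ 1 * S ℤ 11 +
    4723310592 * S ℤ 3 * S ℤ 9 + 14169931776 * S ℤ 5 * S ℤ 7 + 786432 * S ℤ 13 := by
  have h := mom_hser_succ 13
  norm_num [sum_range_succ, Nat.choose, mom_ell, mom_hser_zero, mom_hser_2, mom_hser_4,
      mom_hser_6, mom_hser_8, mom_hser_10, mom_hser_12] at h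
  rw [h]
  ring

lemma Bser_1 : 1 * Bser 1 =
    -36 * S ℤ 1 ^ 2 + 2 * S ℤ 1 - 2 * S ℤ 3 := by
  have h := mom_hser 4
  rw [mom_hser_4] at h
  norm_num [sum_range_succ, Nat.choose] at h
  refine intCast_mul_left_cancel (c := 384) (by norm_num) ?_
  push_cast
  linear_combination 1 * h

lemma Bser_3 : 5 * Bser 3 =
    -4320 * S ℤ 1 ^ 3 + 540 * S ℤ 1 ^ 2 - 720 * S ℤ 1 * S ℤ 3 - 22 * S ℤ 1 + 30 * S ℤ 3 - 8 * S
    ℤ 5 := by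
  have h := mom_hser 6
  rw [mom_hser_6] at h
  norm_num [sum_range_succ, Nat.choose] at h
  refine intCast_mul_left_cancel (c := 384) (by norm_num) ?_
  push_cast
  linear_combination 1 * h - 5760 * Bser_1

lemma Bser_5 : 7 * Bser 5 =
    -362880 * S ℤ 1 ^ 4 + 60480 * S ℤ 1 ^ 3 - 120960 * S ℤ 1 ^ 2 * S ℤ 3 - 4284 * S ℤ 1 ^ 2 +
    10080 * S ℤ 1 * S ℤ 3 - 2688 * S ℤ 1 * S ℤ 5 - 3360 * S ℤ 3 ^ 2 + 142 * S ℤ 1 - 238 * S ℤ 3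
    + 112 * S ℤ 5 - 16 * S ℤ 7 := by
  have h := mom_hser 8
  rw [mom_hser_8] at h
  norm_num [sum_range_succ, Nat.choose] at h
  refine intCast_mul_left_cancel (c := 768) (by norm_num) ?_
  push_cast
  linear_combination 1 * h - 69888 * Bser_1 - 10752 * Bser_3

lemma Bser_7 : 15 * Bser 7 =
    -78382080 * S ℤ 1 ^ 5 + 16329600 * S ℤ 1 ^ 4 - 43545600 * S ℤ 1 ^ 3 * S ℤ 3 - 1542240 * S ℤ
    1 ^ 3 + 5443200 * S ℤ 1 ^ 2 * S ℤ 3 - 1451520 * S ℤ 1 ^ 2 * S ℤ 5 - 3628800 * S ℤ 1 * S ℤ 3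
    ^ 2 + 82260 * S ℤ 1 ^ 2 - 257040 * S ℤ 1 * S ℤ 3 + 120960 * S ℤ 1 * S ℤ 5 - 17280 * S ℤ 1 *
    S ℤ 7 + 151200 * S ℤ 3 ^ 2 - 80640 * S ℤ 3 * S ℤ 5 - 2370 * S ℤ 1 + 4570 * S ℤ 3 - 2856 * S
    ℤ 5 + 720 * S ℤ 7 - 64 * S ℤ 9 := by
  have h := mom_hser 10
  rw [mom_hser_10] at h
  norm_num [sum_range_succ, Nat.choose] at h
  refine intCast_mul_left_cancel (c := 768) (by norm_num) ?_
  push_cast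
  linear_combination 1 * h - 787200 * Bser_1 - 209664 * Bser_3 - 34560 * Bser_5

lemma Bser_9 : 55 * Bser 9 =
    -41385738240 * S ℤ 1 ^ 6 + 10346434560 * S ℤ 1 ^ 5 - 34488115200 * S ℤ 1 ^ 4 * S ℤ 3 -
    1221454080 * S ℤ 1 ^ 4 + 5748019200 * S ℤ 1 ^ 3 * S ℤ 3 - 1532805120 * S ℤ 1 ^ 3 * S ℤ 5 -
    5748019200 * S ℤ 1 ^ 2 * S ℤ 3 ^ 2 + 86866560 * S ℤ 1 ^ 3 - 407151360 * S ℤ 1 ^ 2 * S ℤ 3 +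
    191600640 * S ℤ 1 ^ 2 * S ℤ 5 - 27371520 * S ℤ 1 ^ 2 * S ℤ 7 + 479001600 * S ℤ 1 * S ℤ 3 ^
    2 - 255467520 * S ℤ 1 * S ℤ 3 * S ℤ 5 - 106444800 * S ℤ 3 ^ 3 - 3904956 * S ℤ 1 ^ 2 +
    14477760 * S ℤ 1 * S ℤ 3 - 9047808 * S ℤ 1 * S ℤ 5 + 2280960 * S ℤ 1 * S ℤ 7 - 202752 * S ℤ
    1 * S ℤ 9 - 11309760 * S ℤ 3 ^ 2 + 10644480 * S ℤ 3 * S ℤ 5 - 1520640 * S ℤ 3 * S ℤ 7 -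
    1419264 * S ℤ 5 ^ 2 + 101998 * S ℤ 1 - 216942 * S ℤ 3 + 160864 * S ℤ 5 - 53856 * S ℤ 7 +
    8448 * S ℤ 9 - 512 * S ℤ 11 := by
  have h := mom_hser 12
  rw [mom_hser_12] at h
  norm_num [sum_range_succ, Nat.choose] at h
  refine intCast_mul_left_cancel (c := 384) (by norm_num) ?_
  push_cast
  linear_combination 1 * h - 8502912 * Bser_1 - 3463680 * Bser_3 - 988416 * Bser_5 - 50688 * Bser_7

lemma Bser_11 : 11025 * Bser 11 =
    -1564380905472000 * S ℤ 1 ^ 7 + 456277764096000 * S ℤ 1 ^ 6 - 1825111056384000 * S ℤ 1 ^ 5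
    * S ℤ 3 - 64639349913600 * S ℤ 1 ^ 5 + 380231470080000 * S ℤ 1 ^ 4 * S ℤ 3 -
    101395058688000 * S ℤ 1 ^ 4 * S ℤ 5 - 506975293440000 * S ℤ 1 ^ 3 * S ℤ 3 ^ 2 +
    5746222944000 * S ℤ 1 ^ 4 - 35910749952000 * S ℤ 1 ^ 3 * S ℤ 3 + 16899176448000 * S ℤ 1 ^ 3
    * S ℤ 5 - 2414168064000 * S ℤ 1 ^ 3 * S ℤ 7 + 63371911680000 * S ℤ 1 ^ 2 * S ℤ 3 ^ 2 -
    33798352896000 * S ℤ 1 ^ 2 * S ℤ 3 * S ℤ 5 - 28165294080000 * S ℤ 1 * S ℤ 3 ^ 3 -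
    344417119200 * S ℤ 1 ^ 3 + 1915407648000 * S ℤ 1 ^ 2 * S ℤ 3 - 1197024998400 * S ℤ 1 ^ 2 *
    S ℤ 5 + 301771008000 * S ℤ 1 ^ 2 * S ℤ 7 - 26824089600 * S ℤ 1 ^ 2 * S ℤ 9 - 2992562496000
    * S ℤ 1 * S ℤ 3 ^ 2 + 2816529408000 * S ℤ 1 * S ℤ 3 * S ℤ 5 - 402361344000 * S ℤ 1 * S ℤ 3
    * S ℤ 7 - 375537254400 * S ℤ 1 * S ℤ 5 ^ 2 + 1173553920000 * S ℤ 3 ^ 3 - 938843136000 * S ℤ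
    3 ^ 2 * S ℤ 5 + 13832361900 * S ℤ 1 ^ 2 - 57402853200 * S ℤ 1 * S ℤ 3 + 42564614400 * S ℤ 1
    * S ℤ 5 - 14250297600 * S ℤ 1 * S ℤ 7 + 2235340800 * S ℤ 1 * S ℤ 9 - 145797120 * S ℤ 1 * S
    ℤ 11 + 53205768000 * S ℤ 3 ^ 2 - 66501388800 * S ℤ 3 * S ℤ 5 + 16765056000 * S ℤ 3 * S ℤ 7
    - 1679462400 * S ℤ 3 * S ℤ 9 + 15647385600 * S ℤ 5 ^ 2 - 5151928320 * S ℤ 5 * S ℤ 7 -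
    336742526 * S ℤ 1 + 769181350 * S ℤ 3 - 639228744 * S ℤ 5 + 254712480 * S ℤ 7 - 53567360 *
    S ℤ 9 + 6074880 * S ℤ 11 - 430080 * dq ℤ (S ℤ 11) := by
  have h := mom_hser 14
  rw [mom_hser_14] at h
  norm_num [sum_range_succ, Nat.choose] at h
  refine intCast_mul_left_cancel (c := 1664) (by norm_num) ?_
  push_cast
  linear_combination 525 * h - 46873008000 * Bser_1 - 27081774720 * Bser_3 - 11819808000 * Bser_5 - 1049368320 *
    Bser_7 - 18345600 * Bser_9 + 262144 * dq_S_11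

end SptMoments
end SptThirteen

namespace SptThirteen
open PowerSeries

section EisensteinSeries

open UpperHalfPlane ModularForm ModularFormClass EisensteinSeries
open scoped MatrixGroups ArithmeticFunction.sigma

lemma sum_range_ite_mul_eq (N : ℕ) (hN : N ≠ 0) (d : ℕ) (x : ℤ) :
    (∑ r ∈ range (N + 1), if (r + 1) * d = N then x else 0) = if d ∣ N then x else 0 := by
  split_ifs with h
  · obtain ⟨e, rfl⟩ := h
    obtain ⟨hd, he⟩ := mul_ne_zero_iff.1 hN
    rw [Finset.sum_eq_single (e - 1)]
    · rw [Nat.sub_add_cancel (Nat.pos_of_ne_zero he), mul_comm, if_pos rfl]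
    · intro r _ hr
      rw [if_neg]
      intro h
      rw [mul_comm] at h
      have := Nat.eq_of_mul_eq_mul_left (Nat.pos_of_ne_zero hd) h
      omega
    · intro h
      have := Nat.le_mul_of_pos_left e (Nat.pos_of_ne_zero hd)
      rw [mem_range] at h
      omega
  · exact Finset.sum_eq_zero fun r _ => if_neg fun hr => h ⟨r + 1, by rw [← hr, mul_comm]⟩

lemma coeff_S (j N : ℕ) (hN : N ≠ 0) : coeff N (S ℤ j) = (σ j N : ℤ) := by
  rw [S, coeff_dsum sexp_le _ N.lt_succ_self, Finset.sum_comm]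
  simp only [Nat.succ_eq_add_one, sum_range_ite_mul_eq N hN]
  rw [sum_range_succ, if_neg fun h => by have := Nat.le_of_dvd (Nat.pos_of_ne_zero hN) h; omega,
    add_zero, ArithmeticFunction.sigma_apply, Nat.divisors, Finset.sum_filter,
    Finset.sum_Ico_eq_sum_range]
  push_cast
  exact Finset.sum_congr rfl fun i _ => by rw [add_comm 1 i, add_comm 1 (i : ℤ)]

lemma constantCoeff_S (j : ℕ) : coeff 0 (S ℤ j) = 0 := by
  simp [S, coeff_dsum sexp_le _ Nat.zero_lt_one]

lemma qExpansion_E {k : ℕ} (hk : 3 ≤ k) (hk2 : Even k) {c : ℤ}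
    (hc : -(2 * k / bernoulli k) = c) :
    qExpansion 1 (E hk) = (1 + (c : ℤ⟦X⟧) * S ℤ (k - 1)).map (Int.castRingHom ℂ) := by
  ext n
  have hc' : -(2 * k / bernoulli k : ℂ) = c := by exact_mod_cast congrArg (Rat.cast : ℚ → ℂ) hc
  rw [E_qExpansion_coeff hk hk2, coeff_map, map_add, ← zsmul_eq_mul, map_zsmul, smul_eq_mul]
  split_ifs with h
  · simp [h, constantCoeff_S]
  · simp [coeff_one, h, hc', coeff_S]

lemma E_eight_eq : E (show 3 ≤ 8 by norm_num) = ModularForm.mcast (by decide) (E₄.pow 2) := by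
  rw [← sub_eq_zero]
  refine sturm_bound_levelOne_nat (pos_iff_ne_zero.2 ?_)
  rw [PowerSeries.order_ne_zero_iff_constCoeff_eq_zero,
      ← PowerSeries.coeff_zero_eq_constantCoeff_apply, FunLike.coe_sub, coe_mcast,
    ModularForm.qExpansion_sub one_pos one_mem_strictPeriods_SL,
    ModularForm.qExpansion_pow one_pos one_mem_strictPeriods_SL, map_sub,
        PowerSeries.coeff_zero_eq_constantCoeff_apply,
    PowerSeries.coeff_zero_eq_constantCoeff_apply, map_pow]
  have h4 := E_qExpansion_coeff_zero (show 3 ≤ 4 by norm_num) ⟨2, rfl⟩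
  have h8 := E_qExpansion_coeff_zero (show 3 ≤ 8 by norm_num) ⟨4, rfl⟩
  rw [PowerSeries.coeff_zero_eq_constantCoeff_apply] at h4 h8
  rw [h4, h8, one_pow, sub_self]

/-- The identity `E₈ = E₄ ^ 2`. -/
lemma S_seven : S ℤ 7 = S ℤ 3 + 120 * S ℤ 3 ^ 2 := by
  have h4 := qExpansion_E (show 3 ≤ 4 by norm_num) ⟨2, rfl⟩ (c := 240)
    (by norm_num [show bernoulli 4 = -1 / 30 by decide +kernel])
  have h8 := qExpansion_E (show 3 ≤ 8 by norm_num) ⟨4, rfl⟩ (c := 480)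
    (by norm_num [show bernoulli 8 = -1 / 30 by decide +kernel])
  have h : qExpansion 1 (E (show 3 ≤ 8 by norm_num)) = qExpansion 1 E₄ ^ 2 := by
    rw [E_eight_eq, coe_mcast, ModularForm.qExpansion_pow one_pos one_mem_strictPeriods_SL]
  rw [h4, h8, ← map_pow] at h
  have h' := PowerSeries.map_injective _ (RingHom.injective_int (Int.castRingHom ℂ)) h
  push_cast at h'
  refine intCast_mul_left_cancel (c := 480) (by norm_num) ?_
  push_cast
  linear_combination h'

end EisensteinSeries
end SptThirteen

namespace SptThirteen
open PowerSeries

section ModThirteen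

variable {R : Type*} [CommRing R] [Algebra (ZMod 13) R]

lemma derivation_ofNat (D : Derivation (ZMod 13) R R) (n : ℕ) [n.AtLeastTwo] :
    D (OfNat.ofNat n) = 0 :=
  D.map_natCast n

lemma derivation_ofNat_mul (D : Derivation (ZMod 13) R R) (n : ℕ) [n.AtLeastTwo] (x : R) :
    D (OfNat.ofNat n * x) = OfNat.ofNat n * D x := by
  rw [D.leibniz, derivation_ofNat, smul_zero, add_zero, smul_eq_mul]

variable [hR : CharP R 13]

/-- The Ramanujan differential equations modulo 13 make the weight 14 form below a value of the
operator `24 D - P`. -/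
lemma ramanujan_antiderivative (D : Derivation (ZMod 13) R R) {p q r : R} (hp : D p = q - p ^ 2)
    (hq : D q = 9 * (p * q - r)) (hr : D r = 7 * (p * r - q ^ 2))
    (rel : 441 * q ^ 3 + 250 * r ^ 2 = 691) {w : R}
    (hw : w = 2 * p ^ 6 + 9 * p ^ 4 * q + 9 * p ^ 3 * r + 11 * p ^ 2 * q ^ 2 + 7 * p * q * r +
      2 * q ^ 3 + 6 * r ^ 2 + 6) :
    9 * p ^ 7 + 7 * p ^ 5 * q + 3 * p ^ 4 * r + 3 * p ^ 3 * q ^ 2 + 8 * p ^ 2 * q * r +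
      4 * p * q ^ 3 + 6 * p * r ^ 2 + 2 * q ^ 2 * r + 10 * p = 24 * D w - p * w := by
  have hD : D w = 12 * p ^ 5 * D p + 9 * (4 * p ^ 3 * D p * q + p ^ 4 * D q) +
      9 * (3 * p ^ 2 * D p * r + p ^ 3 * D r) + 11 * (2 * p * D p * q ^ 2 + 2 * p ^ 2 * q * D q) +
      7 * (D p * q * r + p * D q * r + p * q * D r) + 6 * q ^ 2 * D q + 12 * r * D r := by
    rw [hw]
    simp only [map_add, Derivation.leibniz, Derivation.leibniz_pow, smul_eq_mul, nsmul_eq_mul,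
      derivation_ofNat D 2, derivation_ofNat D 6, derivation_ofNat D 7, derivation_ofNat D 9,
      derivation_ofNat D 11]
    push_cast
    ring
  rw [hD, hp, hq, hr, hw]
  linear_combination (norm := (clear * - hR; grind)) 5 * p * rel

lemma exists_eq_antiderivative (D : Derivation (ZMod 13) R R) {s1 s3 s5 s7 s9 s11 a1 a11 b : R}
    (h1 : 6 * D s1 = -12 * s1 ^ 2 + s1 + 5 * s3)
    (h3 : 30 * D s3 = -240 * s1 * s3 - s1 + 10 * s3 + 21 * s5)
    (h5 : 42 * D s5 = -504 * s1 * s5 - 840 * s3 ^ 2 + s1 - 7 * s3 + 21 * s5 + 27 * s7)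
    (h7 : 90 * D s7 = -1440 * s1 * s7 - 10080 * s3 * s5 - 3 * s1 + 20 * s3 - 42 * s5 + 60 * s7 +
      55 * s9)
    (h9 : 66 * D s9 = -1320 * s1 * s9 - 15840 * s3 * s7 - 16632 * s5 ^ 2 + 5 * s1 - 33 * s3 +
      66 * s5 - 66 * s7 + 55 * s9 + 39 * s11)
    (hs7 : s7 = s3 + 120 * s3 ^ 2)
    (hb : 11025 * b = -1564380905472000 * s1 ^ 7 + 456277764096000 * s1 ^ 6 - 1825111056384000 * s1 ^ 5 * s3 -
    64639349913600 * s1 ^ 5 + 380231470080000 * s1 ^ 4 * s3 - 101395058688000 * s1 ^ 4 * s5 -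
    506975293440000 * s1 ^ 3 * s3 ^ 2 + 5746222944000 * s1 ^ 4 - 35910749952000 * s1 ^ 3 * s3 +
    16899176448000 * s1 ^ 3 * s5 - 2414168064000 * s1 ^ 3 * s7 + 63371911680000 * s1 ^ 2 * s3 ^ 2 -
    33798352896000 * s1 ^ 2 * s3 * s5 - 28165294080000 * s1 * s3 ^ 3 - 344417119200 * s1 ^ 3 +
    1915407648000 * s1 ^ 2 * s3 - 1197024998400 * s1 ^ 2 * s5 + 301771008000 * s1 ^ 2 * s7 -
    26824089600 * s1 ^ 2 * s9 - 2992562496000 * s1 * s3 ^ 2 + 2816529408000 * s1 * s3 * s5 -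
    402361344000 * s1 * s3 * s7 - 375537254400 * s1 * s5 ^ 2 + 1173553920000 * s3 ^ 3 -
    938843136000 * s3 ^ 2 * s5 + 13832361900 * s1 ^ 2 - 57402853200 * s1 * s3 + 42564614400 * s1 *
    s5 - 14250297600 * s1 * s7 + 2235340800 * s1 * s9 - 145797120 * s1 * s11 + 53205768000 * s3 ^ 2
    - 66501388800 * s3 * s5 + 16765056000 * s3 * s7 - 1679462400 * s3 * s9 + 15647385600 * s5 ^ 2 -
    5151928320 * s5 * s7 - 336742526 * s1 + 769181350 * s3 - 639228744 * s5 + 254712480 * s7 -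
    53567360 * s9 + 6074880 * s11 -
      430080 * D s11)
    (hb' : b = 24 * D a11 + a1 - (1 - 24 * s1) * a11) :
    ∃ w : R, s1 + a1 = 24 * D w - (1 - 24 * s1) * w := by
  have hred : b = 8 * s1 ^ 7 + 2 * s1 ^ 6 + 5 * s1 ^ 5 * s3 + 6 * s1 ^ 5 + 6 * s1 ^ 4 * s3 + 1 * s1 ^ 4 * s5 + 5
    * s1 ^ 3 * s3 ^ 2 + 6 * s1 ^ 4 + 12 * s1 ^ 3 * s3 + 2 * s1 ^ 3 * s5 + 9 * s1 ^ 3 * s7 + 1 * s1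
    ^ 2 * s3 ^ 2 + 9 * s1 ^ 2 * s3 * s5 + 1 * s1 * s3 ^ 3 + 2 * s1 ^ 3 + 2 * s1 ^ 2 * s3 + 3 * s1 ^
    2 * s5 + 7 * s1 ^ 2 * s7 + 4 * s1 ^ 2 * s9 + 1 * s1 * s3 ^ 2 + 9 * s1 * s3 * s5 + 8 * s1 * s3 *
    s7 + 4 * s1 * s5 ^ 2 + 7 * s3 ^ 3 + 10 * s3 ^ 2 * s5 + 6 * s1 ^ 2 + 9 * s1 * s3 + 9 * s1 * s5 +
    7 * s1 * s7 + 4 * s1 * s9 + 12 * s1 * s11 + 8 * s3 ^ 2 + 11 * s3 * s5 + 4 * s3 * s7 + 8 * s3 *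
    s9 + 2 * s5 ^ 2 + 7 * s5 * s7 + 10 * s1 + 2 * s3 + 2 * s5 + 9 * s7 + 11 * s9 + 6 * s11 - D s11 := by
    linear_combination (norm := (clear * - hR; grind)) hb
  obtain ⟨p, hp⟩ : ∃ p, p = 1 + 2 * s1 := ⟨_, rfl⟩
  obtain ⟨q, hq⟩ : ∃ q, q = 1 + 6 * s3 := ⟨_, rfl⟩
  obtain ⟨r, hr⟩ : ∃ r, r = 1 + 3 * s5 := ⟨_, rfl⟩
  have e1 : s1 = 7 * (p - 1) := by
    linear_combination (norm := (clear * - hR; grind)) (-7) * hp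
  have e3 : s3 = 11 * (q - 1) := by
    linear_combination (norm := (clear * - hR; grind)) (-11) * hq
  have e5 : s5 = 9 * (r - 1) := by
    linear_combination (norm := (clear * - hR; grind)) (-9) * hr
  have e7 : s7 = 1 - q ^ 2 := by
    rw [hs7, e3]
    clear * - hR
    grind
  have hDp : D p = q - p ^ 2 := by
    have : D p = 2 * D s1 := by rw [hp, map_add, derivation_ofNat_mul, D.map_one_eq_zero, zero_add]
    rw [e1, e3] at h1
    rw [this, e1]
    linear_combination (norm := (clear * - hR; grind)) 9 * h1
  have hDq : D q = 9 * (p * q - r) := by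
    have : D q = 6 * D s3 := by rw [hq, map_add, derivation_ofNat_mul, D.map_one_eq_zero, zero_add]
    rw [e1, e3, e5] at h3
    rw [this, e3]
    linear_combination (norm := (clear * - hR; grind)) 8 * h3
  have hDr : D r = 7 * (p * r - q ^ 2) := by
    have : D r = 3 * D s5 := by rw [hr, map_add, derivation_ofNat_mul, D.map_one_eq_zero, zero_add]
    rw [e1, e3, e5, e7] at h5
    rw [this, e5]
    linear_combination (norm := (clear * - hR; grind)) h5
  have hD7 : D s7 = -2 * q * D q := by
    rw [e7, map_sub, D.leibniz_pow, D.map_one_eq_zero]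
    simp
    ring
  have e9 : s9 = 10 * (1 - q * r) := by
    rw [hD7, hDq, e1, e3, e5, e7] at h7
    linear_combination (norm := (clear * - hR; grind)) (-9) * h7
  have hD9 : D s9 = 3 * (q * D r + D q * r) := by
    rw [e9, derivation_ofNat_mul, map_sub, D.leibniz, D.map_one_eq_zero, smul_eq_mul, smul_eq_mul]
    clear * - hR
    grind
  have rel : 441 * q ^ 3 + 250 * r ^ 2 = 691 := by
    rw [hD9, hDr, hDq, e1, e3, e5, e7, e9] at h9
    linear_combination (norm := (clear * - hR; grind)) 3 * h9
  obtain ⟨w, hw⟩ : ∃ w : R, w = 2 * p ^ 6 + 9 * p ^ 4 * q + 9 * p ^ 3 * r + 11 * p ^ 2 * q ^ 2 +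
      7 * p * q * r + 2 * q ^ 3 + 6 * r ^ 2 + 6 := ⟨_, rfl⟩
  have hD := ramanujan_antiderivative D hDp hDq hDr rel hw
  refine ⟨w - a11 + 7 * s11, ?_⟩
  rw [map_add, map_sub, derivation_ofNat_mul]
  rw [e7, e9, e1, e3, e5] at hred
  rw [e1] at hb' ⊢
  linear_combination (norm := (clear * - hR; grind)) hD + hred - hb'

end ModThirteen
end SptThirteen

namespace SptThirteen
open PowerSeries

section SptModThirteen

instance : CharP (ZMod 13)⟦X⟧ 13 :=
  charP_of_injective_ringHom (f := (C : ZMod 13 →+* (ZMod 13)⟦X⟧)) C_injective 13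

lemma A_thirteen : A (ZMod 13) 13 = A (ZMod 13) 1 := by
  have : Fact (Nat.Prime 13) := ⟨by norm_num⟩
  simp only [A, ZMod.pow_card, pow_one]

lemma exists_S_add_A_eq : ∃ w : (ZMod 13)⟦X⟧, S (ZMod 13) 1 + A (ZMod 13) 1 =
    24 * dq (ZMod 13) w - (1 - 24 * S (ZMod 13) 1) * w := by
  let φ := PowerSeries.map (Int.castRingHom (ZMod 13))
  have h1 := congrArg φ dq_S_1
  have h3 := congrArg φ dq_S_3
  have h5 := congrArg φ dq_S_5
  have h7 := congrArg φ dq_S_7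
  have h9 := congrArg φ dq_S_9
  have hs7 := congrArg φ S_seven
  have hb := congrArg φ Bser_11
  have hb' : φ (Bser 11) = φ (24 * dq ℤ (A ℤ 11) + A ℤ 13 - (1 - 24 * S ℤ 1) * A ℤ 11) := rfl
  simp only [φ, map_mul, map_add, map_sub, map_neg, map_pow, map_ofNat, map_dq, map_S]
    at h1 h3 h5 h7 h9 hs7 hb
  simp only [φ, map_mul, map_add, map_sub, map_one, map_ofNat, map_dq, map_S, map_A, A_thirteen]
    at hb'
  exact exists_eq_antiderivative (dq (ZMod 13)) h1 h3 h5 h7 h9 hs7 hb hb'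

lemma thirteen_dvd_spt {m : ℕ} (hm : (24 * m - 1 : ZMod 13) = 0) : (spt m : ZMod 13) = 0 := by
  obtain ⟨w, hw⟩ := exists_S_add_A_eq
  let φ := PowerSeries.map (Int.castRingHom (ZMod 13))
  set E := pentagonalSeries (ZMod 13) with hE
  have h1 : E * φ sptSeries = S (ZMod 13) 1 + A (ZMod 13) 1 := by
    have h := congrArg φ pentagonalSeries_mul_sptSeries
    simpa only [φ, map_mul, map_add, map_S, map_A, map_pentagonalSeries] using h
  have h2 : dq (ZMod 13) E = -S (ZMod 13) 1 * E := by
    have h := congrArg φ dq_pentagonalSeries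
    simpa only [φ, map_mul, map_neg, map_S, map_dq, map_pentagonalSeries] using h
  have hE0 : constantCoeff E = 1 := by
    simpa [pentagonal] using coeff_pentagonalSeries_pentagonal (ZMod 13) 0
  have : Fact (Nat.Prime 13) := ⟨by norm_num⟩
  obtain ⟨u, rfl⟩ : ∃ u, w = E * u :=
    ⟨E⁻¹ * w, by rw [← mul_assoc, PowerSeries.mul_inv_cancel E (by rw [hE0]; exact one_ne_zero),
        one_mul]⟩
  have hEne : E ≠ 0 := by
    intro h
    rw [h, map_zero] at hE0
    exact zero_ne_one hE0
  have h : φ sptSeries = 24 * dq (ZMod 13) u - u := by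
    refine mul_left_cancel₀ hEne ?_
    rw [h1, hw, dq_mul, h2]
    ring
  have hc := congrArg (coeff m) h
  have h24 : 24 * dq (ZMod 13) u = (24 : ℕ) • dq (ZMod 13) u := by rw [nsmul_eq_mul]; rfl
  rw [h24, map_sub, map_nsmul, coeff_dq, coeff_map, sptSeries, coeff_mk, eq_intCast,
      Int.cast_natCast,
    nsmul_eq_mul] at hc
  rw [hc]
  push_cast
  linear_combination hm * coeff m u

end SptModThirteen
end SptThirteen

/-- Andrews' congruence for `spt` modulo 5. -/
theorem spt_congruence_mod_thirteen (n : ℕ) (h : 24 ∣ 13 * n + 1) :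
    13 ∣ spt ((13 * n + 1) / 24) := by
  rw [← ZMod.natCast_eq_zero_iff]
  apply SptThirteen.thirteen_dvd_spt
  obtain ⟨m, hm⟩ := h
  rw [hm, Nat.mul_div_cancel_left _ (by norm_num), sub_eq_zero]
  have : (24 * m : ZMod 13) = ((24 * m : ℕ) : ZMod 13) := by push_cast; rfl
  rw [this, ← hm]
  push_cast
  rw [show (13 : ZMod 13) = 0 from rfl, zero_mul, zero_add]
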